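/- (Existence of equilibrium strategies in the biexponential case) Suppose f′(k∞) lies strictly between g̲_λ(k∞) and ḡ_λ(k∞). Then there exists an equilibrium strategy σ_λ (for the biexponential, time-inconsistent problem with h(t)=e^{−δ₁t}, H(t)=e^{−δ₂t} and U replaced by ((1−λ)/λ)U) defined on a neighborhood of k∞, whose trajectories dk/dt = f(k) − σ_λ(k) converge to k∞. -/

import Mathlib

open MeasureTheory Filter Set

noncomputable def pd1 (u : ℝ → ℝ → ℝ) (c k : ℝ) : ℝ := deriv (fun x => u x k) c
noncomputable def pd2 (u : ℝ → ℝ → ℝ) (c k : ℝ) : ℝ := deriv (fun y => u c y) k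
noncomputable def pd11 (u : ℝ → ℝ → ℝ) (c k : ℝ) : ℝ := deriv (fun x => pd1 u x k) c

noncomputable def Pval (u U : ℝ → ℝ → ℝ) (h H : ℝ → ℝ) (σ : ℝ → ℝ)
    (K R : ℝ → ℝ → ℝ) (k₀ c : ℝ) : ℝ :=
  u c k₀ - u (σ k₀) k₀ + (U c k₀ - U (σ k₀) k₀) +
  ∫ t in Set.Ioi (0:ℝ),
    (h t * (pd1 u (σ (K t k₀)) (K t k₀) * deriv σ (K t k₀) + pd2 u (σ (K t k₀)) (K t k₀)) +
     H t * (pd1 U (σ (K t k₀)) (K t k₀) * deriv σ (K t k₀) + pd2 U (σ (K t k₀)) (K t k₀)))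
    * (R k₀ t * (σ k₀ - c))

/-- `ḡ_λ(k)`. -/
noncomputable def gbar (f : ℝ → ℝ) (u U : ℝ → ℝ → ℝ) (lam δ₁ δ₂ : ℝ) (k : ℝ) : ℝ :=
  (lam * δ₁ * pd1 u (f k) k + (1 - lam) * δ₂ * pd1 U (f k) k) /
    (lam * pd1 u (f k) k + (1 - lam) * pd1 U (f k) k) -
  (lam * pd2 u (f k) k + (1 - lam) * pd2 U (f k) k) /
    (lam * pd1 u (f k) k + (1 - lam) * pd1 U (f k) k)

/-- `g̲_λ(k)`. -/
noncomputable def gunder (f : ℝ → ℝ) (u U : ℝ → ℝ → ℝ) (lam δ₁ δ₂ : ℝ) (k : ℝ) : ℝ :=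
  (lam * pd1 u (f k) k + (1 - lam) * pd1 U (f k) k) /
    (lam / δ₁ * pd1 u (f k) k + (1 - lam) / δ₂ * pd1 U (f k) k) -
  (lam * δ₂ * pd2 u (f k) k + (1 - lam) * δ₁ * pd2 U (f k) k) /
    (lam * δ₂ * pd1 u (f k) k + (1 - lam) * δ₁ * pd1 U (f k) k)

open Topology
open scoped BoundedContinuousFunction

/-- The exponentially weighted past average of `E`. -/
noncomputable def expAverage (γ : ℝ) (E : ℝ → ℝ) (t : ℝ) : ℝ :=
  ∫ θ in Ioi (0 : ℝ), Real.exp (-γ * θ) * E (t - θ)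

lemma integrableOn_expAverage {γ : ℝ} (hγ : 0 < γ) {E : ℝ → ℝ} (hE : Continuous E) {C : ℝ}
    (hC : ∀ t, |E t| ≤ C) (t : ℝ) :
    IntegrableOn (fun θ => Real.exp (-γ * θ) * E (t - θ)) (Ioi 0) := by
  refine (exp_neg_integrableOn_Ioi 0 hγ).mul_bdd (c := C) ?_ ?_
  · exact (hE.comp (continuous_const.sub continuous_id)).aestronglyMeasurable
  · exact Eventually.of_forall fun θ => hC _

lemma abs_expAverage_le {γ : ℝ} (hγ : 0 < γ) {E : ℝ → ℝ} {C : ℝ}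
    (hC : ∀ t, |E t| ≤ C) (t : ℝ) : |expAverage γ E t| ≤ C / γ := by
  have h := norm_integral_le_of_norm_le (μ := volume.restrict (Ioi (0 : ℝ)))
    (f := fun θ => Real.exp (-γ * θ) * E (t - θ)) (g := fun θ => Real.exp (-γ * θ) * C)
    ((exp_neg_integrableOn_Ioi 0 hγ).mul_const C)
    (Eventually.of_forall fun θ => by
      rw [norm_mul, Real.norm_of_nonneg (Real.exp_pos _).le]
      exact mul_le_mul_of_nonneg_left (hC _) (Real.exp_pos _).le)
  have h2 : ∫ θ in Ioi (0 : ℝ), Real.exp (-γ * θ) * C = C / γ := by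
    rw [integral_mul_const, integral_exp_mul_Ioi (by linarith) 0]
    simp
    field_simp
  rw [h2] at h
  exact h

lemma tendsto_expAverage {γ : ℝ} (hγ : 0 < γ) {E : ℝ → ℝ} (hE : Continuous E) {C : ℝ}
    (hC : ∀ t, |E t| ≤ C) {l : Filter ℝ} [l.IsCountablyGenerated]
    (hl : ∀ θ : ℝ, Tendsto (fun t => t - θ) l l) (hE0 : Tendsto E l (𝓝 0)) :
    Tendsto (expAverage γ E) l (𝓝 0) := by
  have := tendsto_integral_filter_of_dominated_convergence
    (μ := volume.restrict (Ioi (0 : ℝ))) (l := l)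
    (F := fun t θ => Real.exp (-γ * θ) * E (t - θ)) (f := fun _ => (0 : ℝ))
    (fun θ => Real.exp (-γ * θ) * C)
    (Eventually.of_forall fun t => (integrableOn_expAverage hγ hE hC t).aestronglyMeasurable)
    (Eventually.of_forall fun t => Eventually.of_forall fun θ => by
      rw [norm_mul, Real.norm_of_nonneg (Real.exp_pos _).le]
      exact mul_le_mul_of_nonneg_left (hC _) (Real.exp_pos _).le)
    ((exp_neg_integrableOn_Ioi 0 hγ).mul_const C)
    (Eventually.of_forall fun θ => by
      simpa using (hE0.comp (hl θ)).const_mul (Real.exp (-γ * θ)))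
  simp only [integral_zero] at this
  exact this

lemma expAverage_eq {γ : ℝ} (hγ : 0 < γ) {E : ℝ → ℝ} (hE : Continuous E) {C : ℝ}
    (hC : ∀ t, |E t| ≤ C) (t : ℝ) :
    expAverage γ E t = Real.exp (-γ * t) *
      ((∫ τ in (0 : ℝ)..t, Real.exp (γ * τ) * E τ) + expAverage γ E 0) := by
  have key : ∀ a : ℝ, IntegrableOn (fun τ => Real.exp (γ * τ) * E τ) (Iic a) ∧
      expAverage γ E a = Real.exp (-γ * a) * ∫ τ in Iic a, Real.exp (γ * τ) * E τ := by
    intro a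
    have h1 : (fun θ => Real.exp (-γ * θ) * E (a - θ)) =
        fun θ => Real.exp (-γ * a) * (fun τ => Real.exp (γ * τ) * E τ) (a - θ) := by
      ext θ
      simp only [← mul_assoc, ← Real.exp_add]
      ring_nf
    have hint := integrableOn_expAverage hγ hE hC a
    constructor
    · rw [h1] at hint
      have h3 := hint.const_mul (Real.exp (γ * a))
      have h4 : IntegrableOn (fun θ => (fun τ => Real.exp (γ * τ) * E τ) (a - θ)) (Ioi 0) := by
        refine h3.congr (Eventually.of_forall fun θ => ?_)
        simp only [← mul_assoc, ← Real.exp_add]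
        ring_nf
      have h5 := (Measure.measurePreserving_sub_left volume a).integrableOn_comp_preimage
        (MeasurableEquiv.subLeft a).measurableEmbedding
        (f := fun τ => Real.exp (γ * τ) * E τ) (s := Iio a)
      rw [integrableOn_Iic_iff_integrableOn_Iio]
      refine h5.1 ?_
      have : (fun x => a - x) ⁻¹' Iio a = Ioi 0 := by ext; simp
      rw [this]; exact h4
    · rw [expAverage, h1, integral_const_mul]
      congr 1
      rw [integral_Iic_eq_integral_Iio]
      have h5 := (Measure.measurePreserving_sub_left volume a).setIntegral_preimage_emb
        (MeasurableEquiv.subLeft a).measurableEmbedding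
        (fun τ => Real.exp (γ * τ) * E τ) (Iio a)
      rw [← h5]
      have : (fun x => a - x) ⁻¹' Iio a = Ioi 0 := by ext; simp
      rw [this]
  rw [(key t).2, (key 0).2, ← intervalIntegral.integral_Iic_sub_Iic (key 0).1 (key t).1]
  simp

lemma hasDerivAt_expAverage {γ : ℝ} (hγ : 0 < γ) {E : ℝ → ℝ} (hE : Continuous E) {C : ℝ}
    (hC : ∀ t, |E t| ≤ C) (t : ℝ) :
    HasDerivAt (expAverage γ E) (E t - γ * expAverage γ E t) t := by
  have h1 : HasDerivAt (fun t => Real.exp (-γ * t)) (Real.exp (-γ * t) * (-γ)) t := by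
    simpa using ((hasDerivAt_id t).const_mul (-γ)).exp
  have hcont : Continuous fun τ => Real.exp (γ * τ) * E τ := by fun_prop
  have h2 : HasDerivAt (fun t => (∫ τ in (0 : ℝ)..t, Real.exp (γ * τ) * E τ) + expAverage γ E 0)
      (Real.exp (γ * t) * E t) t :=
    (hcont.integral_hasStrictDerivAt 0 t).hasDerivAt.add_const _
  have h3 := h1.mul h2
  have h4 : expAverage γ E = (fun t => Real.exp (-γ * t)) * (fun t =>
      (∫ τ in (0 : ℝ)..t, Real.exp (γ * τ) * E τ) + expAverage γ E 0) :=
    funext fun t => expAverage_eq hγ hE hC t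
  rw [h4]
  refine h3.congr_deriv ?_
  have h5 : Real.exp (-γ * t) * Real.exp (γ * t) = 1 := by rw [← Real.exp_add]; simp
  simp only [Pi.mul_apply]
  linear_combination (E t) * h5

/-- The bounded solution operator of `deriv r = -κ r - E`. -/
lemma exists_bounded_solution_operator {κ : ℝ} (hκ : κ ≠ 0) :
    ∃ S : (ℝ →ᵇ ℝ) → (ℝ →ᵇ ℝ),
      (∀ E₁ E₂, dist (S E₁) (S E₂) ≤ dist E₁ E₂ / |κ|) ∧
      (∀ E t, HasDerivAt (S E) (-κ * S E t - E t) t) ∧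
      (∀ E : ℝ →ᵇ ℝ, Tendsto E atTop (𝓝 0) → Tendsto (S E) atTop (𝓝 0)) := by
  have hsub : ∀ γ : ℝ, 0 < γ → ∀ (E₁ E₂ : ℝ → ℝ) (C₁ C₂ C : ℝ), Continuous E₁ → Continuous E₂ →
      (∀ t, |E₁ t| ≤ C₁) → (∀ t, |E₂ t| ≤ C₂) → (∀ t, |E₁ t - E₂ t| ≤ C) → ∀ t,
      |expAverage γ E₁ t - expAverage γ E₂ t| ≤ C / γ := by
    intro γ hγ E₁ E₂ C₁ C₂ C h1 h2 hC1 hC2 hC t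
    have : expAverage γ E₁ t - expAverage γ E₂ t = expAverage γ (fun t => E₁ t - E₂ t) t := by
      unfold expAverage
      rw [← integral_sub (integrableOn_expAverage hγ h1 hC1 t) (integrableOn_expAverage hγ h2 hC2 t)]
      simp only [mul_sub]
    rw [this]
    exact abs_expAverage_le hγ hC t
  have hb : ∀ (E : ℝ →ᵇ ℝ) (t : ℝ), |E t| ≤ ‖E‖ := fun E t => E.norm_coe_le_norm t
  have hd : ∀ (E₁ E₂ : ℝ →ᵇ ℝ) (t : ℝ), |E₁ t - E₂ t| ≤ dist E₁ E₂ := fun E₁ E₂ t => by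
    rw [← Real.dist_eq]
    exact BoundedContinuousFunction.dist_coe_le_dist t
  rcases lt_or_gt_of_ne hκ with hneg | hpos
  · have hγ : 0 < -κ := by linarith
    have hder : ∀ (E : ℝ →ᵇ ℝ) (t : ℝ), HasDerivAt (fun t => expAverage (-κ) (fun t => E (-t)) (-t))
        (-κ * expAverage (-κ) (fun t => E (-t)) (-t) - E t) t := by
      intro E t
      have h := (hasDerivAt_expAverage hγ (E := fun t => E (-t)) (by fun_prop)
        (fun t => hb E (-t)) (-t)).scomp t (hasDerivAt_neg t)
      refine h.congr_deriv ?_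
      simp; ring
    refine ⟨fun E => BoundedContinuousFunction.ofNormedAddCommGroup
      (fun t => expAverage (-κ) (fun t => E (-t)) (-t))
      (continuous_iff_continuousAt.2 fun t => (hder E t).continuousAt) (‖E‖ / (-κ))
      (fun t => abs_expAverage_le hγ (fun t => hb E (-t)) (-t)), ?_, ?_, ?_⟩
    · intro E₁ E₂
      rw [abs_of_neg hneg, BoundedContinuousFunction.dist_le (by positivity)]
      intro t
      exact hsub _ hγ (fun t => E₁ (-t)) (fun t => E₂ (-t)) _ _ _ (by fun_prop) (by fun_prop)
        (fun t => hb _ _) (fun t => hb _ _) (fun t => hd _ _ _) (-t)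
    · intro E t
      exact hder E t
    · intro E hE
      have h := tendsto_expAverage hγ (E := fun t => E (-t)) (by fun_prop)
        (fun t => hb E (-t)) (l := atBot) (fun θ => tendsto_atBot_add_const_right _ (-θ) tendsto_id)
        (hE.comp tendsto_neg_atBot_atTop)
      exact h.comp tendsto_neg_atTop_atBot
  · have hder : ∀ (E : ℝ →ᵇ ℝ) (t : ℝ), HasDerivAt (fun t => -expAverage κ E t)
        (-κ * (-expAverage κ E t) - E t) t := by
      intro E t
      have h := (hasDerivAt_expAverage hpos E.continuous (hb E) t).neg
      refine h.congr_deriv ?_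
      ring
    refine ⟨fun E => BoundedContinuousFunction.ofNormedAddCommGroup
      (fun t => -expAverage κ E t)
      (continuous_iff_continuousAt.2 fun t => (hder E t).continuousAt) (‖E‖ / κ)
      (fun t => by simpa using abs_expAverage_le hpos (hb E) t), ?_, ?_, ?_⟩
    · intro E₁ E₂
      rw [abs_of_pos hpos, BoundedContinuousFunction.dist_le (by positivity)]
      intro t
      have := hsub _ hpos E₁ E₂ _ _ _ E₁.continuous E₂.continuous (hb _) (hb _) (hd _ _) t
      simp only [BoundedContinuousFunction.coe_ofNormedAddCommGroup, dist_neg_neg]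
      exact this
    · intro E t
      exact hder E t
    · intro E hE
      have h := tendsto_expAverage hpos E.continuous (hb E) (l := atTop)
        (fun θ => tendsto_atTop_add_const_right _ (-θ) tendsto_id) hE
      simpa using h.neg

/-- The function `x ↦ r (1 / x)` on the positive half-line, extended by zero. -/
noncomputable def invPullback (r : ℝ → ℝ) (x : ℝ) : ℝ := if 0 < x then r (1 / x) else 0

/-- The mean of `invPullback r` over `(0, x)`. -/
noncomputable def invMean (r : ℝ → ℝ) (x : ℝ) : ℝ := (∫ y in (0 : ℝ)..x, invPullback r y) / x

lemma abs_invPullback_le (r : ℝ →ᵇ ℝ) (x : ℝ) : |invPullback r x| ≤ ‖r‖ := by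
  unfold invPullback
  split_ifs
  · exact r.norm_coe_le_norm _
  · simp

lemma intervalIntegrable_invPullback (r : ℝ →ᵇ ℝ) (a b : ℝ) :
    IntervalIntegrable (invPullback r) volume a b := by
  have hm : Measurable (invPullback r) :=
    Measurable.ite measurableSet_Ioi
      (r.continuous.measurable.comp (measurable_const.div measurable_id)) measurable_const
  refine (intervalIntegrable_const (c := ‖r‖)).mono_fun hm.aestronglyMeasurable ?_
  refine Eventually.of_forall fun x => ?_
  simpa using abs_invPullback_le r x

lemma abs_invMean_le_of_le {r : ℝ → ℝ} {x C : ℝ} (hx : 0 < x)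
    (h : ∀ y ∈ Ioc 0 x, |invPullback r y| ≤ C) : |invMean r x| ≤ C := by
  have := intervalIntegral.norm_integral_le_of_norm_le_const (a := 0) (b := x)
    (f := invPullback r) (C := C) (by rwa [uIoc_of_le hx.le])
  rw [invMean, abs_div, abs_of_pos hx, div_le_iff₀ hx]
  simpa [abs_of_pos hx] using this

lemma abs_invMean_sub_le (r₁ r₂ : ℝ →ᵇ ℝ) {x : ℝ} (hx : 0 < x) :
    |invMean r₁ x - invMean r₂ x| ≤ dist r₁ r₂ := by
  have h : invMean r₁ x - invMean r₂ x = invMean (r₁ - r₂ : ℝ →ᵇ ℝ) x := by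
    unfold invMean
    rw [← sub_div, ← intervalIntegral.integral_sub (intervalIntegrable_invPullback _ _ _)
      (intervalIntegrable_invPullback _ _ _)]
    congr 2
    ext y
    unfold invPullback
    split_ifs <;> simp
  rw [h, dist_eq_norm]
  exact abs_invMean_le_of_le hx fun y _ => abs_invPullback_le _ y

lemma continuousOn_invMean (r : ℝ →ᵇ ℝ) : ContinuousOn (invMean r) (Ioi 0) := by
  refine ContinuousOn.div ?_ continuousOn_id fun x hx => ne_of_gt hx
  exact (intervalIntegral.continuous_primitive
    (fun a b => intervalIntegrable_invPullback r a b) 0).continuousOn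

lemma tendsto_invPullback {r : ℝ → ℝ} (hr : Tendsto r atTop (𝓝 0)) :
    Tendsto (invPullback r) (𝓝 0) (𝓝 0) := by
  rw [Metric.tendsto_nhds]
  intro ε hε
  have h := (hr.comp tendsto_inv_nhdsGT_zero).eventually (Metric.ball_mem_nhds 0 hε)
  rw [eventually_nhdsWithin_iff] at h
  filter_upwards [h] with x hx
  unfold invPullback
  split_ifs with h0
  · simpa using hx h0
  · simpa using hε

lemma tendsto_invMean {r : ℝ → ℝ} (hr : Tendsto r atTop (𝓝 0)) :
    Tendsto (invMean r) (𝓝[>] 0) (𝓝 0) := by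
  rw [Metric.tendsto_nhds]
  intro ε hε
  obtain ⟨d, hd, h⟩ := Metric.eventually_nhds_iff.1
    ((tendsto_invPullback hr).eventually (Metric.ball_mem_nhds 0 (half_pos hε)))
  filter_upwards [Ioo_mem_nhdsGT hd] with x hx
  rw [dist_zero_right, Real.norm_eq_abs]
  refine lt_of_le_of_lt (abs_invMean_le_of_le hx.1 (C := ε / 2) fun y hy => ?_) (half_lt_self hε)
  have := @h y (by rw [Real.dist_eq, sub_zero, abs_of_pos hy.1]; exact hy.2.trans_lt hx.2)
  rw [dist_zero_right] at this
  exact this.le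

lemma isClosed_tendsto_zero : IsClosed {r : ℝ →ᵇ ℝ | Tendsto r atTop (𝓝 0)} := by
  refine isClosed_of_closure_subset fun r hr => ?_
  rw [mem_ofPred_eq, Metric.tendsto_nhds]
  intro ε hε
  obtain ⟨q, hq, hd⟩ := Metric.mem_closure_iff.1 hr (ε / 2) (half_pos hε)
  filter_upwards [(Metric.tendsto_nhds.1 hq) (ε / 2) (half_pos hε)] with t ht
  calc dist (r t) 0 ≤ dist (r t) (q t) + dist (q t) 0 := dist_triangle _ _ _
    _ < ε / 2 + ε / 2 := add_lt_add ((BoundedContinuousFunction.dist_coe_le_dist t).trans_lt hd) ht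
    _ = ε := add_halves ε

lemma exists_solution_right {Φ : ℝ × ℝ × ℝ → ℝ} {s κ : ℝ} {L : ℝ × ℝ × ℝ →L[ℝ] ℝ} (hκ : κ ≠ 0)
    (hΦ : Φ (0, s, s) = 0) (hL : HasStrictFDerivAt Φ L (0, s, s)) (hLz : L (0, 1, 0) = 0)
    (hLρ : L (0, 0, 1) = κ) (hcont : ∀ᶠ p in 𝓝 ((0 : ℝ), s, s), ContinuousAt Φ p) :
    ∃ ε > 0, ∃ ρ : ℝ → ℝ, Continuous ρ ∧ ρ 0 = s ∧
      ∀ x ∈ Ioo 0 ε, HasDerivAt ρ (Φ (x, (∫ y in (0 : ℝ)..x, ρ y) / x, ρ x) / x ^ 2) x := by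
  have hκ' : 0 < |κ| := abs_pos.2 hκ
  obtain ⟨η, hη, hlip, hcη⟩ : ∃ η > 0,
      (∀ p ∈ Metric.closedBall ((0 : ℝ), s, s) η, ∀ q ∈ Metric.closedBall ((0 : ℝ), s, s) η,
        |Φ p - Φ q - L (p - q)| ≤ |κ| / 2 * ‖p - q‖) ∧
      ∀ p ∈ Metric.closedBall ((0 : ℝ), s, s) η, ContinuousAt Φ p := by
    have h1 := hL.isLittleO.def (half_pos hκ')
    rw [nhds_prod_eq] at h1
    obtain ⟨V, hV, hV2⟩ := mem_prod_same_iff.1 h1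
    obtain ⟨η, hη, hsub⟩ := Metric.nhds_basis_closedBall.mem_iff.1 (inter_mem hV hcont)
    exact ⟨η, hη, fun p hp q hq => hV2 (mk_mem_prod (hsub hp).1 (hsub hq).1), fun p hp => (hsub hp).2⟩
  obtain ⟨S, hS, hSd, hSt⟩ := exists_bounded_solution_operator hκ
  set c : ℝ → ℝ := fun y => max (-η) (min y η) with hc
  have hcc : Continuous c := by fun_prop
  have hcη' : ∀ y, |c y| ≤ η := fun y =>
    abs_le.2 ⟨le_max_left _ _, max_le (by linarith) (min_le_right _ _)⟩
  have hcl : ∀ y y', |c y - c y'| ≤ |y - y'| := fun y y' => by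
    have h1 := abs_max_sub_max_le_max (-η) (min y η) (-η) (min y' η)
    have h2 := abs_min_sub_min_le_max y η y' η
    simp only [sub_self, abs_zero, abs_nonneg, sup_of_le_left, sup_of_le_right] at h1 h2
    exact h1.trans h2
  have hc0 : ∀ y, |y| ≤ η → c y = y := fun y hy => by
    rw [abs_le] at hy
    simp [hc, min_eq_left hy.2, max_eq_right hy.1]
  set ξ : ℝ → ℝ := fun t => 1 / max t (1 / η) with hξ
  have hξpos : ∀ t, 0 < ξ t := fun t => by
    have : 0 < max t (1 / η) := lt_max_of_lt_right (by positivity)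
    positivity
  have hξle : ∀ t, ξ t ≤ η := fun t => by
    have h : 1 / η ≤ max t (1 / η) := le_max_right _ _
    calc ξ t ≤ 1 / (1 / η) := one_div_le_one_div_of_le (by positivity) h
      _ = η := by simp
  have hξc : Continuous ξ := by
    refine continuous_const.div (by fun_prop) fun t => ?_
    have : 0 < max t (1 / η) := lt_max_of_lt_right (by positivity)
    exact this.ne'
  have hξt : Tendsto ξ atTop (𝓝[>] 0) := by
    refine tendsto_nhdsWithin_iff.2 ⟨?_, Eventually.of_forall hξpos⟩
    simp only [hξ, one_div]
    exact tendsto_inv_atTop_zero.comp (tendsto_atTop_mono (fun t => le_max_left _ _) tendsto_id)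
  set P : (ℝ →ᵇ ℝ) → ℝ → ℝ × ℝ × ℝ :=
    fun r t => (ξ t, s + c (invMean r (ξ t)), s + c (r t)) with hP
  have hPm : ∀ r t, P r t ∈ Metric.closedBall ((0 : ℝ), s, s) η := by
    intro r t
    simp only [hP, mem_closedBall_iff_norm, Prod.mk_sub_mk, Prod.norm_mk, Real.norm_eq_abs,
      sup_le_iff, sub_zero, add_sub_cancel_left]
    exact ⟨by rw [abs_of_pos (hξpos t)]; exact hξle t, hcη' _, hcη' _⟩
  have hPc : ∀ r, Continuous (P r) := by
    intro r
    have : Continuous fun t => invMean r (ξ t) :=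
      (continuousOn_invMean r).comp_continuous hξc hξpos
    have h2 : Continuous r := r.continuous
    fun_prop
  set E₀ : (ℝ →ᵇ ℝ) → ℝ → ℝ := fun r t => Φ (P r t) - κ * c (r t) with hE₀
  have hE₀c : ∀ r, Continuous (E₀ r) := by
    intro r
    have h1 : Continuous fun t => Φ (P r t) := continuous_iff_continuousAt.2 fun t =>
      ContinuousAt.comp (hcη _ (hPm r t)) (hPc r).continuousAt
    exact h1.sub (continuous_const.mul (hcc.comp r.continuous))
  have hE₀b : ∀ r t, ‖E₀ r t‖ ≤ (|κ| / 2 * η + ‖L‖ * η) + |κ| * η := by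
    intro r t
    have h1 := hlip _ (hPm r t) _ (Metric.mem_closedBall_self hη.le)
    have h2 : ‖P r t - (0, s, s)‖ ≤ η := mem_closedBall_iff_norm.1 (hPm r t)
    have h3 := L.le_opNorm (P r t - (0, s, s))
    have h4 : ‖L‖ * ‖P r t - (0, s, s)‖ ≤ ‖L‖ * η := by gcongr
    have h5 : |κ| / 2 * ‖P r t - (0, s, s)‖ ≤ |κ| / 2 * η := by gcongr
    have h6 : |κ * c (r t)| ≤ |κ| * η := by
      rw [abs_mul]; exact mul_le_mul_of_nonneg_left (hcη' _) (abs_nonneg _)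
    rw [hΦ] at h1
    rw [Real.norm_eq_abs] at h3 ⊢
    rw [abs_le] at *
    constructor <;> simp only [hE₀] <;> linarith
  have hlin : ∀ a b : ℝ, L (0, a, b) = κ * b := by
    intro a b
    have : ((0 : ℝ), a, b) = a • ((0 : ℝ), (1 : ℝ), (0 : ℝ)) + b • ((0 : ℝ), (0 : ℝ), (1 : ℝ)) := by
      simp
    rw [this, map_add, map_smul, map_smul, hLz, hLρ]
    simp [mul_comm]
  have hE₀l : ∀ r₁ r₂ t, |E₀ r₁ t - E₀ r₂ t| ≤ |κ| / 2 * dist r₁ r₂ := by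
    intro r₁ r₂ t
    have h1 := hlip _ (hPm r₁ t) _ (hPm r₂ t)
    have h2 : P r₁ t - P r₂ t =
        (0, c (invMean r₁ (ξ t)) - c (invMean r₂ (ξ t)), c (r₁ t) - c (r₂ t)) := by
      simp [hP]
    rw [h2, hlin] at h1
    have h3 : E₀ r₁ t - E₀ r₂ t = Φ (P r₁ t) - Φ (P r₂ t) - κ * (c (r₁ t) - c (r₂ t)) := by
      simp only [hE₀]; ring
    rw [h3]
    refine h1.trans (mul_le_mul_of_nonneg_left ?_ (by positivity))
    simp only [Prod.norm_mk, norm_zero, Real.norm_eq_abs, sup_le_iff]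
    refine ⟨dist_nonneg, (hcl _ _).trans (abs_invMean_sub_le _ _ (hξpos t)), (hcl _ _).trans ?_⟩
    rw [← Real.dist_eq]
    exact BoundedContinuousFunction.dist_coe_le_dist t
  set E : (ℝ →ᵇ ℝ) → (ℝ →ᵇ ℝ) := fun r =>
    BoundedContinuousFunction.ofNormedAddCommGroup (E₀ r) (hE₀c r) _ (hE₀b r) with hE
  have hcontr : ContractingWith (1 / 2) fun r => S (E r) := by
    refine ⟨by norm_num, LipschitzWith.of_dist_le_mul fun r₁ r₂ => (hS _ _).trans ?_⟩
    rw [div_le_iff₀ hκ', BoundedContinuousFunction.dist_le (by positivity)]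
    intro t
    rw [Real.dist_eq]
    refine (hE₀l r₁ r₂ t).trans (le_of_eq ?_)
    simp
    ring
  have hlim : ∀ r : ℝ →ᵇ ℝ, Tendsto r atTop (𝓝 0) →
      Tendsto (fun t => invMean r (ξ t)) atTop (𝓝 0) := fun r hr => (tendsto_invMean hr).comp hξt
  have hcz : c 0 = 0 := hc0 0 (by simpa using hη.le)
  have hmaps : MapsTo (fun r => S (E r)) {r : ℝ →ᵇ ℝ | Tendsto r atTop (𝓝 0)}
      {r : ℝ →ᵇ ℝ | Tendsto r atTop (𝓝 0)} := by
    intro r hr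
    refine hSt _ ?_
    have h1 : Tendsto (P r) atTop (𝓝 (0, s, s)) := by
      have ha : Tendsto (fun t => s + c (invMean r (ξ t))) atTop (𝓝 s) := by
        simpa [hcz] using ((hcc.tendsto 0).comp (hlim r hr)).const_add s
      have hb : Tendsto (fun t => s + c (r t)) atTop (𝓝 s) := by
        simpa [hcz] using ((hcc.tendsto 0).comp hr).const_add s
      exact (hξt.mono_right nhdsWithin_le_nhds).prodMk_nhds (ha.prodMk_nhds hb)
    have h2 : Tendsto (fun t => Φ (P r t)) atTop (𝓝 0) := by
      have := (hcη _ (Metric.mem_closedBall_self hη.le)).tendsto.comp h1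
      rwa [hΦ] at this
    have h3 : Tendsto (fun t => κ * c (r t)) atTop (𝓝 0) := by
      simpa [hcz] using ((hcc.tendsto 0).comp hr).const_mul κ
    have h4 := h2.sub h3
    rw [sub_zero] at h4
    exact h4
  obtain ⟨r, hrfix, hr0⟩ : ∃ r : ℝ →ᵇ ℝ, S (E r) = r ∧ Tendsto r atTop (𝓝 0) := by
    refine ⟨hcontr.fixedPoint _, hcontr.fixedPoint_isFixedPt, ?_⟩
    refine isClosed_tendsto_zero.mem_of_tendsto (hcontr.tendsto_iterate_fixedPoint 0)
      (Eventually.of_forall fun n => hmaps.iterate n ?_)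
    exact tendsto_const_nhds
  have hrd : ∀ t, HasDerivAt r (-κ * r t - E₀ r t) t := by
    intro t
    have := hSd (E r) t
    rwa [hrfix] at this
  have hev : ∀ᶠ t in atTop, |r t| ≤ η ∧ |invMean r (ξ t)| ≤ η ∧ 1 / η ≤ t := by
    have h1 := hr0.eventually (Metric.closedBall_mem_nhds 0 hη)
    have h2 := (hlim r hr0).eventually (Metric.closedBall_mem_nhds 0 hη)
    filter_upwards [h1, h2, eventually_ge_atTop (1 / η)] with t ha hb hc
    exact ⟨by simpa using ha, by simpa using hb, hc⟩
  have hev2 := tendsto_inv_nhdsGT_zero.eventually hev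
  rw [eventually_nhdsWithin_iff, Metric.eventually_nhds_iff] at hev2
  obtain ⟨ε, hε, hev2⟩ := hev2
  refine ⟨ε, hε, fun x => s + invPullback r x, ?_, by simp [invPullback], ?_⟩
  · rw [continuous_iff_continuousAt]
    intro x
    refine continuousAt_const.add ?_
    rcases lt_trichotomy x 0 with hx | rfl | hx
    · refine (continuousAt_const (y := (0 : ℝ))).congr ?_
      filter_upwards [Iio_mem_nhds hx] with y hy
      simp [invPullback, not_lt.2 (le_of_lt (mem_Iio.1 hy))]
    · have := tendsto_invPullback hr0
      rwa [ContinuousAt, show invPullback r 0 = 0 by simp [invPullback]]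
    · have h1 : ContinuousAt (fun y => r (1 / y)) x :=
        r.continuous.continuousAt.comp (continuousAt_const.div continuousAt_id hx.ne')
      refine h1.congr ?_
      filter_upwards [Ioi_mem_nhds hx] with y hy
      simp [invPullback, mem_Ioi.1 hy]
  · intro x hx
    obtain ⟨ha, hb, hd⟩ := hev2 (y := x) (by
      rw [Real.dist_eq, sub_zero, abs_of_pos hx.1]; exact hx.2) hx.1
    have hξx : ξ x⁻¹ = x := by simp only [hξ]; rw [max_eq_left hd]; simp
    rw [hξx] at hb
    have h1 : HasDerivAt (fun y => s + r (y⁻¹)) ((-κ * r x⁻¹ - E₀ r x⁻¹) * (-(x ^ 2)⁻¹)) x :=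
      ((hrd x⁻¹).comp x (hasDerivAt_inv hx.1.ne')).const_add s
    have h2 : HasDerivAt (fun x => s + invPullback r x)
        ((-κ * r x⁻¹ - E₀ r x⁻¹) * (-(x ^ 2)⁻¹)) x := by
      refine h1.congr_of_eventuallyEq ?_
      filter_upwards [Ioi_mem_nhds hx.1] with y hy
      simp [invPullback, mem_Ioi.1 hy]
    refine h2.congr_deriv ?_
    have h3 : (∫ y in (0 : ℝ)..x, (s + invPullback r y)) / x = s + invMean r x := by
      rw [intervalIntegral.integral_add (by simp) (intervalIntegrable_invPullback r 0 x)]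
      have := hx.1.ne'
      simp [invMean, add_div]
      field_simp
    have h4 : invPullback r x = r x⁻¹ := by simp [invPullback, hx.1]
    rw [h3]
    simp only [h4, hE₀, hP, hξx, hc0 _ ha, hc0 _ hb]
    ring

lemma exists_solution_two_sided {Φ : ℝ × ℝ × ℝ → ℝ} {s κ : ℝ} {L : ℝ × ℝ × ℝ →L[ℝ] ℝ}
    (hκ : κ ≠ 0) (hΦ : Φ (0, s, s) = 0) (hL : HasStrictFDerivAt Φ L (0, s, s))
    (hLz : L (0, 1, 0) = 0) (hLρ : L (0, 0, 1) = κ)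
    (hcont : ∀ᶠ p in 𝓝 ((0 : ℝ), s, s), ContinuousAt Φ p) :
    ∃ ε > 0, ∃ ρ : ℝ → ℝ, Continuous ρ ∧ ρ 0 = s ∧
      ∀ x ≠ 0, |x| < ε →
        HasDerivAt ρ (Φ (x, (∫ y in (0 : ℝ)..x, ρ y) / x, ρ x) / x ^ 2) x := by
  obtain ⟨ε₁, hε₁, ρ₁, hc₁, h0₁, hd₁⟩ := exists_solution_right hκ hΦ hL hLz hLρ hcont
  set A : ℝ × ℝ × ℝ →L[ℝ] ℝ × ℝ × ℝ :=
    (-(ContinuousLinearMap.fst ℝ ℝ (ℝ × ℝ))).prod (ContinuousLinearMap.snd ℝ ℝ (ℝ × ℝ)) with hA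
  have hA0 : A (0, s, s) = (0, s, s) := by simp [hA]
  obtain ⟨ε₂, hε₂, ρ₂, hc₂, h0₂, hd₂⟩ := exists_solution_right (Φ := fun p => -Φ (A p)) (s := s)
    (κ := -κ) (L := -(L.comp A)) (neg_ne_zero.2 hκ) (by simp [hA0, hΦ])
    (HasStrictFDerivAt.neg (HasStrictFDerivAt.comp (0, s, s) (by rw [hA0]; exact hL)
      A.hasStrictFDerivAt))
    (by simp [hA, hLz]) (by simp [hA, hLρ])
    (by
      have hAt : Tendsto A (𝓝 (0, s, s)) (𝓝 (0, s, s)) := by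
        have := A.continuous.tendsto (0, s, s)
        rwa [hA0] at this
      filter_upwards [hAt.eventually hcont] with p hp
      exact (ContinuousAt.comp hp A.continuous.continuousAt).neg)
  set ρ : ℝ → ℝ := fun x => if 0 ≤ x then ρ₁ x else ρ₂ (-x) with hρ
  have hpos : ∀ x, 0 ≤ x → ρ x = ρ₁ x := fun x hx => by simp [hρ, hx]
  have hneg : ∀ x, x ≤ 0 → ρ x = ρ₂ (-x) := fun x hx => by
    rcases hx.eq_or_lt with rfl | hx
    · simp [hρ, h0₁, h0₂]
    · simp [hρ, not_le.2 hx]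
  refine ⟨min ε₁ ε₂, lt_min hε₁ hε₂, ρ, ?_, by simp [hρ, h0₁], ?_⟩
  · exact hc₁.if_le (hc₂.comp continuous_neg) continuous_const continuous_id
      (fun x hx => by simp [← hx, h0₁, h0₂])
  · intro x hx0 hx
    rcases lt_or_gt_of_ne hx0 with hlt | hgt
    · rw [abs_of_neg hlt] at hx
      have h1 := (hd₂ (-x) ⟨by linarith, hx.trans_le (min_le_right _ _)⟩).scomp x (hasDerivAt_neg x)
      have h2 : HasDerivAt ρ _ x := h1.congr_of_eventuallyEq (by
        filter_upwards [Iio_mem_nhds hlt] with y hy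
        exact hneg y (le_of_lt (mem_Iio.1 hy)))
      refine h2.congr_deriv ?_
      have h3 : ∫ y in (0 : ℝ)..x, ρ y = -∫ y in (0 : ℝ)..(-x), ρ₂ y := by
        rw [← intervalIntegral.integral_symm]
        have := intervalIntegral.integral_comp_neg (a := 0) (b := x) ρ₂
        rw [neg_zero] at this
        rw [← this]
        refine intervalIntegral.integral_congr fun y hy => hneg y ?_
        rw [uIcc_of_ge hlt.le] at hy
        exact hy.2
      rw [h3, hneg x hlt.le]
      simp [hA, neg_div, div_neg]
    · rw [abs_of_pos hgt] at hx
      have h1 := hd₁ x ⟨hgt, hx.trans_le (min_le_left _ _)⟩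
      have h2 : HasDerivAt ρ _ x := h1.congr_of_eventuallyEq (by
        filter_upwards [Ioi_mem_nhds hgt] with y hy
        exact hpos y (le_of_lt (mem_Ioi.1 hy)))
      refine h2.congr_deriv ?_
      have h3 : ∫ y in (0 : ℝ)..x, ρ y = ∫ y in (0 : ℝ)..x, ρ₁ y := by
        refine intervalIntegral.integral_congr fun y hy => hpos y ?_
        rw [uIcc_of_le hgt.le] at hy
        exact hy.1
      rw [h3, hpos x hgt.le]

/-- A second-order equation `g² deriv (deriv g) = Ψ(k, g, deriv g)` with an irregular singular
point at a zero of `g` has a `C¹` solution through that zero with prescribed positive slope. -/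
lemma exists_solution_irregular_singular {Ψ : ℝ × ℝ × ℝ → ℝ} {k₀ s κ : ℝ} (hs : 0 < s)
    (hκ : κ ≠ 0) (hΨ : ContDiffAt ℝ 1 Ψ (k₀, 0, s)) (hΨ0 : Ψ (k₀, 0, s) = 0)
    (hΨρ : HasDerivAt (fun ρ => Ψ (k₀, 0, ρ)) κ s) :
    ∃ ε > 0, ∃ ρ g : ℝ → ℝ, Continuous ρ ∧ ρ k₀ = s ∧ g k₀ = 0 ∧ (∀ k, HasDerivAt g (ρ k) k) ∧
      ∀ k ≠ k₀, |k - k₀| < ε → HasDerivAt ρ (Ψ (k, g k, ρ k) / g k ^ 2) k := by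
  set Φ : ℝ × ℝ × ℝ → ℝ := fun p => Ψ (k₀ + p.1, p.1 * p.2.1, p.2.2) / p.2.1 ^ 2 with hΦdef
  have hΦc : ContDiffAt ℝ 1 Φ (0, s, s) := by
    have h1 : ContDiffAt ℝ 1 (fun p : ℝ × ℝ × ℝ => (k₀ + p.1, p.1 * p.2.1, p.2.2)) (0, s, s) := by
      fun_prop
    have h2 : ContDiffAt ℝ 1 Ψ ((fun p : ℝ × ℝ × ℝ => (k₀ + p.1, p.1 * p.2.1, p.2.2)) (0, s, s)) := by
      simpa using hΨ
    refine (h2.comp (0, s, s) h1).div (by fun_prop) (by simpa using hs.ne')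
  have hL := hΦc.hasStrictFDerivAt (by simp)
  have hLz : fderiv ℝ Φ (0, s, s) (0, 1, 0) = 0 := by
    have hcurve : HasDerivAt (fun z : ℝ => ((0 : ℝ), z, s)) (0, 1, 0) s :=
      (hasDerivAt_const _ _).prodMk ((hasDerivAt_id s).prodMk (hasDerivAt_const _ _))
    have h1 := hL.hasFDerivAt.comp_hasDerivAt s hcurve
    have h2 : Φ ∘ (fun z : ℝ => ((0 : ℝ), z, s)) = fun _ => 0 := by
      ext z; simp [hΦdef, hΨ0]
    rw [h2] at h1
    exact h1.unique (hasDerivAt_const _ _)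
  have hLρ : fderiv ℝ Φ (0, s, s) (0, 0, 1) = κ / s ^ 2 := by
    have hcurve : HasDerivAt (fun z : ℝ => ((0 : ℝ), s, z)) (0, 0, 1) s :=
      (hasDerivAt_const _ _).prodMk ((hasDerivAt_const _ _).prodMk (hasDerivAt_id s))
    have h1 := hL.hasFDerivAt.comp_hasDerivAt s hcurve
    have h2 : Φ ∘ (fun z : ℝ => ((0 : ℝ), s, z)) = fun z => Ψ (k₀, 0, z) / s ^ 2 := by
      ext z; simp [hΦdef]
    rw [h2] at h1
    exact h1.unique (hΨρ.div_const _)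
  obtain ⟨ε, hε, r, hrc, hr0, hrd⟩ := exists_solution_two_sided (div_ne_zero hκ (by positivity))
    (by simp [hΦdef, hΨ0]) hL hLz hLρ
    ((hΦc.eventually (by simp)).mono fun p hp => hp.continuousAt)
  refine ⟨ε, hε, fun k => r (k - k₀), fun k => ∫ y in (0 : ℝ)..(k - k₀), r y, by fun_prop,
    by simpa using hr0, by simp, ?_, ?_⟩
  · intro k
    have h := (hrc.integral_hasStrictDerivAt 0 (k - k₀)).hasDerivAt
    exact h.comp_sub_const k k₀
  · intro k hk hkε
    have hx : k - k₀ ≠ 0 := sub_ne_zero.2 hk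
    refine ((hrd (k - k₀) hx hkε).comp_sub_const k k₀).congr_deriv ?_
    simp only [hΦdef]
    rw [mul_div_cancel₀ _ hx, add_sub_cancel]
    field_simp

lemma ne_zero_of_hasDerivAt_pos {g ρ : ℝ → ℝ} {k₀ ε : ℝ} (hg0 : g k₀ = 0)
    (hg : ∀ k, HasDerivAt g (ρ k) k) (hρ : ∀ k, |k - k₀| < ε → 0 < ρ k) {k : ℝ} (hk : k ≠ k₀)
    (hkε : |k - k₀| < ε) : g k ≠ 0 := by
  intro h
  have hc : Continuous g := continuous_iff_continuousAt.2 fun k => (hg k).continuousAt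
  rw [abs_lt] at hkε
  rcases lt_or_gt_of_ne hk with hlt | hgt
  · obtain ⟨c, hc1, hc2⟩ := exists_hasDerivAt_eq_zero hlt hc.continuousOn (by rw [h, hg0])
      fun x _ => hg x
    exact (hρ c (by rw [abs_lt]; constructor <;> linarith [hc1.1, hc1.2])).ne' hc2
  · obtain ⟨c, hc1, hc2⟩ := exists_hasDerivAt_eq_zero hgt hc.continuousOn (by rw [h, hg0])
      fun x _ => hg x
    exact (hρ c (by rw [abs_lt]; constructor <;> linarith [hc1.1, hc1.2])).ne.symm hc2

/-- Solvability of `deriv (g M) = -D` with coefficients in `(k, g, deriv g)` near a zero of `g`. -/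
lemma exists_solution_balance {M D e : ℝ × ℝ × ℝ → ℝ} {k₀ s m : ℝ} (hs : 0 < s) (hm : m ≠ 0)
    (hM : ContDiffAt ℝ 2 M (k₀, 0, s)) (hD : ContDiffAt ℝ 1 D (k₀, 0, s))
    (he : ContDiffAt ℝ 1 e (k₀, 0, s)) (he0 : e (k₀, 0, s) ≠ 0)
    (hMρ : ∀ᶠ p in 𝓝 (k₀, (0 : ℝ), s), fderiv ℝ M p (0, 0, 1) = p.2.1 * e p)
    (hbal : ∀ᶠ ρ in 𝓝 s, D (k₀, 0, ρ) + ρ * M (k₀, 0, ρ) = m * (ρ - s)) :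
    ∃ ε > 0, ∃ ρ g : ℝ → ℝ, Continuous ρ ∧ ρ k₀ = s ∧ g k₀ = 0 ∧ (∀ k, HasDerivAt g (ρ k) k) ∧
      ∀ k ≠ k₀, |k - k₀| < ε → HasDerivAt (fun k => M (k, g k, ρ k))
        (-(D (k, g k, ρ k) + ρ k * M (k, g k, ρ k)) / g k) k := by
  set Ψ : ℝ × ℝ × ℝ → ℝ := fun p =>
    -(D p + p.2.2 * M p + p.2.1 * fderiv ℝ M p (1, p.2.2, 0)) / e p with hΨdef
  have hM1 : ContDiffAt ℝ 1 M (k₀, 0, s) := hM.of_le (by norm_num)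
  have hfM : ContDiffAt ℝ 1 (fderiv ℝ M) (k₀, 0, s) := hM.fderiv_right (by norm_num)
  have hΨ : ContDiffAt ℝ 1 Ψ (k₀, 0, s) := by
    have h1 : ContDiffAt ℝ 1 (fun p : ℝ × ℝ × ℝ => fderiv ℝ M p (1, p.2.2, 0)) (k₀, 0, s) :=
      hfM.clm_apply (by fun_prop)
    exact ((hD.add ((by fun_prop : ContDiffAt ℝ 1 (fun p : ℝ × ℝ × ℝ => p.2.2) _).mul hM1)).add
      ((by fun_prop : ContDiffAt ℝ 1 (fun p : ℝ × ℝ × ℝ => p.2.1) _).mul h1)).neg.div he he0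
  have hev : (fun ρ => Ψ (k₀, 0, ρ)) =ᶠ[𝓝 s] fun ρ => -(m * (ρ - s)) / e (k₀, 0, ρ) := by
    filter_upwards [hbal] with ρ hρ
    simp only [hΨdef, hρ, zero_mul, add_zero]
  have hΨ0 : Ψ (k₀, 0, s) = 0 := by simpa using hev.self_of_nhds
  have hΨρ : HasDerivAt (fun ρ => Ψ (k₀, 0, ρ)) (-m / e (k₀, 0, s)) s := by
    refine HasDerivAt.congr_of_eventuallyEq ?_ hev
    have hcurve : HasDerivAt (fun z : ℝ => (k₀, (0 : ℝ), z)) (0, 0, 1) s :=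
      (hasDerivAt_const _ _).prodMk ((hasDerivAt_const _ _).prodMk (hasDerivAt_id s))
    have h1 := (he.differentiableAt (by simp)).hasFDerivAt.comp_hasDerivAt s hcurve
    have h2 : HasDerivAt (fun ρ : ℝ => -(m * (ρ - s))) (-m) s := by
      exact (((hasDerivAt_id s).sub_const s).const_mul m).neg.congr_deriv (by simp)
    refine (h2.div h1 he0).congr_deriv ?_
    simp
    field_simp
  obtain ⟨ε₁, hε₁, ρ, g, hρc, hρ0, hg0, hgd, hρd⟩ := exists_solution_irregular_singular hs
    (div_ne_zero (neg_ne_zero.2 hm) he0) hΨ hΨ0 hΨρ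
  have hgc : Continuous g := continuous_iff_continuousAt.2 fun k => (hgd k).continuousAt
  have hev2 : ∀ᶠ k in 𝓝 k₀, (fderiv ℝ M (k, g k, ρ k) (0, 0, 1) = g k * e (k, g k, ρ k) ∧
      DifferentiableAt ℝ M (k, g k, ρ k) ∧ e (k, g k, ρ k) ≠ 0) ∧ 0 < ρ k := by
    have ht : Tendsto (fun k => (k, g k, ρ k)) (𝓝 k₀) (𝓝 (k₀, 0, s)) := by
      have : Continuous fun k => (k, g k, ρ k) := by fun_prop
      simpa [hg0, hρ0] using this.tendsto k₀
    refine (ht.eventually (hMρ.and (((hM1.eventually (by simp)).mono fun p hp =>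
      hp.differentiableAt (by simp)).and (he.continuousAt.eventually_ne he0)))).and ?_
    exact hρc.continuousAt.eventually (lt_mem_nhds (by rw [hρ0]; exact hs))
  obtain ⟨ε₂, hε₂, hev2⟩ := Metric.eventually_nhds_iff.1 hev2
  refine ⟨min ε₁ ε₂, lt_min hε₁ hε₂, ρ, g, hρc, hρ0, hg0, hgd, fun k hk hkε => ?_⟩
  have hgk : g k ≠ 0 := ne_zero_of_hasDerivAt_pos hg0 hgd (ε := min ε₁ ε₂)
    (fun k hk => (hev2 (hk.trans_le (min_le_right _ _))).2) hk hkε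
  obtain ⟨⟨h1, h2, h3⟩, -⟩ := hev2 (y := k) (hkε.trans_le (min_le_right _ _))
  have hcurve := (hasDerivAt_id k).prodMk
    ((hgd k).prodMk (hρd k hk (hkε.trans_le (min_le_left _ _))))
  refine (h2.hasFDerivAt.comp_hasDerivAt k hcurve).congr_deriv ?_
  have hvec : ((1 : ℝ), ρ k, Ψ (k, g k, ρ k) / g k ^ 2) =
      (1, ρ k, 0) + (Ψ (k, g k, ρ k) / g k ^ 2) • ((0 : ℝ), (0 : ℝ), (1 : ℝ)) := by simp
  rw [hvec, map_add, map_smul, h1]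
  simp only [hΨdef, smul_eq_mul]
  field_simp
  ring

/-- Global solvability of a scalar autonomous equation with speed bounded away from `0` and `∞`. -/
lemma exists_autonomous_solution {w : ℝ → ℝ} {a b : ℝ} (hw : Continuous w) (ha : 0 < a)
    (hwa : ∀ y, a ≤ w y) (hwb : ∀ y, w y ≤ b) (y₀ : ℝ) :
    ∃ y : ℝ → ℝ, y 0 = y₀ ∧ ∀ t, HasDerivAt y (w (y t)) t := by
  have hwpos : ∀ y, 0 < w y := fun y => ha.trans_le (hwa y)
  have hb : 0 < b := (hwpos 0).trans_le (hwb 0)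
  have hc : Continuous fun y => (w y)⁻¹ := hw.inv₀ fun y => (hwpos y).ne'
  set G : ℝ → ℝ := fun y => ∫ η in y₀..y, (w η)⁻¹ with hG
  have hGd : ∀ y, HasDerivAt G (w y)⁻¹ y := fun y =>
    (hc.integral_hasStrictDerivAt y₀ y).hasDerivAt
  have hG0 : G y₀ = 0 := by simp [hG]
  have hGc : Continuous G := continuous_iff_continuousAt.2 fun y => (hGd y).continuousAt
  have hGm : StrictMono G := strictMono_of_deriv_pos fun y => by
    rw [(hGd y).deriv]; exact inv_pos.2 (hwpos y)
  have hH : Monotone fun y => G y - b⁻¹ * y := by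
    have hd : ∀ y, HasDerivAt (fun y => G y - b⁻¹ * y) ((w y)⁻¹ - b⁻¹) y := fun y =>
      ((hGd y).sub ((hasDerivAt_id y).const_mul b⁻¹)).congr_deriv (by simp)
    refine monotone_of_deriv_nonneg (fun y => (hd y).differentiableAt) fun y => ?_
    rw [(hd y).deriv, sub_nonneg]
    exact inv_anti₀ (hwpos y) (hwb y)
  have htop : Tendsto G atTop atTop := by
    have h1 : Tendsto (fun y => b⁻¹ * y + (G 0 - b⁻¹ * 0)) atTop atTop :=
      tendsto_atTop_add_const_right _ _ (tendsto_id.const_mul_atTop (inv_pos.2 hb))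
    refine tendsto_atTop_mono' _ ?_ h1
    filter_upwards [eventually_ge_atTop 0] with y hy
    have := hH hy
    simp only at this
    linarith
  have hbot : Tendsto G atBot atBot := by
    have h1 : Tendsto (fun y => b⁻¹ * y + (G 0 - b⁻¹ * 0)) atBot atBot :=
      tendsto_atBot_add_const_right _ _ (tendsto_id.const_mul_atBot (inv_pos.2 hb))
    refine tendsto_atBot_mono' _ ?_ h1
    filter_upwards [eventually_le_atBot 0] with y hy
    have := hH hy
    simp only at this
    linarith
  set e := hGm.orderIsoOfSurjective G (hGc.surjective htop hbot) with he
  have hinv : ∀ t, G (e.symm t) = t := fun t => e.apply_symm_apply t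
  refine ⟨e.symm, ?_, fun t => ?_⟩
  · exact hGm.injective (by rw [hinv, hG0])
  · have := HasDerivAt.of_local_left_inverse (e.symm.continuous.continuousAt (x := t))
      (hGd (e.symm t)) (inv_ne_zero (hwpos _).ne') (Eventually.of_forall hinv)
    simpa using this

/-- Trajectories of `deriv K = -g(K)` near an attracting zero of `g`. -/
lemma exists_attracted_trajectory {g ρ : ℝ → ℝ} {k₀ ε a b : ℝ} (ha : 0 < a) (hg0 : g k₀ = 0)
    (hg : ∀ k, HasDerivAt g (ρ k) k) (hρ : ∀ k, |k - k₀| < ε → a ≤ ρ k ∧ ρ k ≤ b)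
    {k : ℝ} (hk : |k - k₀| < ε) :
    ∃ K : ℝ → ℝ, K 0 = k ∧ Continuous K ∧ (∀ t, 0 ≤ t → HasDerivAt K (-g (K t)) t) ∧
      (∀ t, 0 ≤ t → |K t - k₀| < ε) ∧ Tendsto K atTop (𝓝 k₀) ∧
      ((∀ t, K t ≠ k₀) ∨ ∀ t, K t = k₀) := by
  rcases eq_or_ne k k₀ with rfl | hne
  · exact ⟨fun _ => k, rfl, continuous_const, fun t _ => by simpa [hg0] using hasDerivAt_const t k,
      fun _ _ => hk, tendsto_const_nhds, Or.inr fun _ => rfl⟩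
  have hgc : Continuous g := continuous_iff_continuousAt.2 fun k => (hg k).continuousAt
  set d := k - k₀ with hd
  have hd0 : d ≠ 0 := sub_ne_zero.2 hne
  have hslope : ∀ x, x ≠ 0 → |x| < ε → a ≤ g (k₀ + x) / x ∧ g (k₀ + x) / x ≤ b := by
    intro x hx hxε
    have hlt := abs_lt.1 hxε
    rcases lt_or_gt_of_ne hx with h | h
    · obtain ⟨c, hc1, hc2⟩ := exists_hasDerivAt_eq_slope g ρ (a := k₀ + x) (b := k₀) (by linarith)
        hgc.continuousOn fun y _ => hg y
      have h1 : g (k₀ + x) / x = ρ c := by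
        rw [hc2, hg0, zero_sub, show k₀ - (k₀ + x) = -x by ring, neg_div_neg_eq]
      rw [h1]
      exact hρ c (by rw [abs_lt]; constructor <;> linarith [hc1.1, hc1.2])
    · obtain ⟨c, hc1, hc2⟩ := exists_hasDerivAt_eq_slope g ρ (a := k₀) (b := k₀ + x) (by linarith)
        hgc.continuousOn fun y _ => hg y
      have h1 : g (k₀ + x) / x = ρ c := by
        rw [hc2, hg0, sub_zero, add_sub_cancel_left]
      rw [h1]
      exact hρ c (by rw [abs_lt]; constructor <;> linarith [hc1.1, hc1.2])
  set X : ℝ → ℝ := fun y => d * Real.exp (-y) with hX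
  have hX0 : ∀ y, X y ≠ 0 := fun y => mul_ne_zero hd0 (Real.exp_pos _).ne'
  have hXε : ∀ y, 0 ≤ y → |X y| < ε := fun y hy => by
    rw [abs_mul, abs_of_pos (Real.exp_pos _)]
    exact (mul_le_of_le_one_right (abs_nonneg _) (Real.exp_le_one_iff.2 (by linarith))).trans_lt hk
  set w : ℝ → ℝ := fun y => g (k₀ + X (max y 0)) / X (max y 0) with hw
  have hwc : Continuous w := by
    have hXc : Continuous X := by fun_prop
    exact Continuous.div (by fun_prop) (by fun_prop) fun y => hX0 _
  obtain ⟨y, hy0, hyd⟩ := exists_autonomous_solution hwc ha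
    (fun y => (hslope _ (hX0 _) (hXε _ (le_max_right _ _))).1)
    (fun y => (hslope _ (hX0 _) (hXε _ (le_max_right _ _))).2) 0
  have hmono : Monotone fun t => y t - a * t := by
    have hd : ∀ t, HasDerivAt (fun t => y t - a * t) (w (y t) - a) t := fun t =>
      ((hyd t).sub ((hasDerivAt_id t).const_mul a)).congr_deriv (by simp)
    refine monotone_of_deriv_nonneg (fun t => (hd t).differentiableAt) fun t => ?_
    rw [(hd t).deriv, sub_nonneg]
    exact (hslope _ (hX0 _) (hXε _ (le_max_right _ _))).1
  have hyge : ∀ t, 0 ≤ t → a * t ≤ y t := fun t ht => by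
    have := hmono ht
    simp only [hy0, mul_zero, sub_zero] at this
    linarith
  have hypos : ∀ t, 0 ≤ t → 0 ≤ y t := fun t ht => (mul_nonneg ha.le ht).trans (hyge t ht)
  have hyc : Continuous y := continuous_iff_continuousAt.2 fun t => (hyd t).continuousAt
  refine ⟨fun t => k₀ + X (y t), by simp [hX, hy0, hd], by fun_prop, fun t ht => ?_,
    fun t ht => by simpa using hXε _ (hypos t ht), ?_, Or.inl fun t => by simpa using hX0 _⟩
  · have h1 : HasDerivAt (fun t => k₀ + X (y t)) (d * (Real.exp (-y t) * (-w (y t)))) t :=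
      (((hyd t).neg.exp).const_mul d).const_add k₀
    refine h1.congr_deriv ?_
    simp only [hw, max_eq_left (hypos t ht)]
    have := hX0 (y t)
    field_simp
    simp only [hX]
  · have h1 : Tendsto y atTop atTop := by
      refine tendsto_atTop_mono' _ ?_ (tendsto_id.const_mul_atTop ha)
      filter_upwards [eventually_ge_atTop 0] with t ht using hyge t ht
    have h2 := ((Real.tendsto_exp_neg_atTop_nhds_zero.comp h1).const_mul d).const_add k₀
    simpa [hX] using h2


/-- The value at time `0` of a costate driven by a discounted marginal payoff. -/
lemma integral_discounted_eq {y a r R : ℝ → ℝ} {δ La Ly : ℝ} (hδ : 0 < δ)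
    (hy : ∀ t, 0 ≤ t → HasDerivAt y ((δ + r t) * y t - a t) t)
    (hR : ∀ t, 0 ≤ t → HasDerivAt R (-r t * R t) t) (hR0 : R 0 = 1)
    (hRb : ∀ t, 0 ≤ t → |R t| ≤ 1) (ha : ContinuousOn a (Ici 0))
    (haL : Tendsto a atTop (𝓝 La)) (hyL : Tendsto y atTop (𝓝 Ly)) :
    IntegrableOn (fun t => Real.exp (-δ * t) * a t * R t) (Ioi 0) ∧
      ∫ t in Ioi 0, Real.exp (-δ * t) * a t * R t = y 0 := by
  have hRO : R =O[atTop] fun _ => (1 : ℝ) := by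
    refine Asymptotics.IsBigO.of_bound 1 ?_
    filter_upwards [eventually_ge_atTop 0] with t ht using by simpa using hRb t ht
  have hexp : (fun t => Real.exp (-δ * t)) =O[atTop] fun t => Real.exp (-δ * t) :=
    Asymptotics.isBigO_refl _ _
  have hRc : ContinuousOn R (Ici 0) := fun t ht => (hR t ht).continuousAt.continuousWithinAt
  have hint : IntegrableOn (fun t => Real.exp (-δ * t) * a t * R t) (Ioi 0) := by
    refine integrable_of_isBigO_exp_neg hδ ?_ ?_
    · exact ((by fun_prop : Continuous fun t => Real.exp (-δ * t)).continuousOn.mul ha).mul hRc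
    · simpa using (hexp.mul (haL.isBigO_one ℝ)).mul hRO
  refine ⟨hint, ?_⟩
  have hd : ∀ t ∈ Ici (0 : ℝ), HasDerivAt (fun t => -(Real.exp (-δ * t) * y t * R t))
      (Real.exp (-δ * t) * a t * R t) t := fun t ht => by
    have h1 : HasDerivAt (fun t => Real.exp (-δ * t)) (Real.exp (-δ * t) * -δ) t :=
      (((hasDerivAt_id t).const_mul (-δ)).congr_deriv (by simp)).exp
    exact (((h1.mul (hy t ht)).mul (hR t ht)).neg).congr_deriv (by simp only [Pi.mul_apply]; ring)
  have hlim : Tendsto (fun t => -(Real.exp (-δ * t) * y t * R t)) atTop (𝓝 0) := by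
    have h0 : Tendsto (fun t => Real.exp (-δ * t)) atTop (𝓝 0) := by
      refine Real.tendsto_exp_atBot.comp ?_
      exact tendsto_id.const_mul_atTop_of_neg (by linarith)
    have h1 : (fun t => -(Real.exp (-δ * t) * y t * R t)) =O[atTop] fun t => Real.exp (-δ * t) := by
      simpa using ((hexp.mul (hyL.isBigO_one ℝ)).mul hRO).neg_left
    exact h1.trans_tendsto h0
  rw [integral_Ioi_of_hasDerivAt_of_tendsto' hd hint hlim]
  simp [hR0]

/-- The positive quadrant is open. -/
lemma isOpen_quadrant : IsOpen (Ioi (0 : ℝ) ×ˢ Ioi (0 : ℝ)) := isOpen_Ioi.prod isOpen_Ioi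

section Partials

variable {F : ℝ → ℝ → ℝ}

lemma differentiableAt_of_quadrant
    (hF : ContDiffOn ℝ (⊤ : ℕ∞) (fun p : ℝ × ℝ => F p.1 p.2) (Ioi 0 ×ˢ Ioi 0))
    {c k : ℝ} (hc : 0 < c) (hk : 0 < k) :
    DifferentiableAt ℝ (fun p : ℝ × ℝ => F p.1 p.2) (c, k) :=
  (hF.contDiffAt (isOpen_quadrant.mem_nhds
    (show (c, k) ∈ Ioi (0 : ℝ) ×ˢ Ioi (0 : ℝ) from ⟨hc, hk⟩))).differentiableAt (by simp)

lemma hasDerivAt_comp_pair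
    (hF : ContDiffOn ℝ (⊤ : ℕ∞) (fun p : ℝ × ℝ => F p.1 p.2) (Ioi 0 ×ˢ Ioi 0))
    {x y : ℝ → ℝ} {x' y' t : ℝ} (hx : HasDerivAt x x' t) (hy : HasDerivAt y y' t)
    (hx0 : 0 < x t) (hy0 : 0 < y t) :
    HasDerivAt (fun t => F (x t) (y t))
      (fderiv ℝ (fun p : ℝ × ℝ => F p.1 p.2) (x t, y t) (x', y')) t := by
  have h1 := (differentiableAt_of_quadrant hF hx0 hy0).hasFDerivAt
  exact h1.comp_hasDerivAt t (hx.prodMk hy)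

lemma pd1_eq_fderiv
    (hF : ContDiffOn ℝ (⊤ : ℕ∞) (fun p : ℝ × ℝ => F p.1 p.2) (Ioi 0 ×ˢ Ioi 0))
    {c k : ℝ} (hc : 0 < c) (hk : 0 < k) :
    pd1 F c k = fderiv ℝ (fun p : ℝ × ℝ => F p.1 p.2) (c, k) (1, 0) :=
  (hasDerivAt_comp_pair hF (hasDerivAt_id c) (hasDerivAt_const c k) hc hk).deriv

lemma pd2_eq_fderiv
    (hF : ContDiffOn ℝ (⊤ : ℕ∞) (fun p : ℝ × ℝ => F p.1 p.2) (Ioi 0 ×ˢ Ioi 0))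
    {c k : ℝ} (hc : 0 < c) (hk : 0 < k) :
    pd2 F c k = fderiv ℝ (fun p : ℝ × ℝ => F p.1 p.2) (c, k) (0, 1) :=
  (hasDerivAt_comp_pair hF (hasDerivAt_const k c) (hasDerivAt_id k) hc hk).deriv

/-- Chain rule in terms of partial derivatives. -/
lemma hasDerivAt_comp_partials
    (hF : ContDiffOn ℝ (⊤ : ℕ∞) (fun p : ℝ × ℝ => F p.1 p.2) (Ioi 0 ×ˢ Ioi 0))
    {x y : ℝ → ℝ} {x' y' t : ℝ} (hx : HasDerivAt x x' t) (hy : HasDerivAt y y' t)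
    (hx0 : 0 < x t) (hy0 : 0 < y t) :
    HasDerivAt (fun t => F (x t) (y t))
      (pd1 F (x t) (y t) * x' + pd2 F (x t) (y t) * y') t := by
  refine (hasDerivAt_comp_pair hF hx hy hx0 hy0).congr_deriv ?_
  have h : ((x', y') : ℝ × ℝ) = x' • ((1, 0) : ℝ × ℝ) + y' • ((0, 1) : ℝ × ℝ) := by simp
  rw [h, map_add, map_smul, map_smul, pd1_eq_fderiv hF hx0 hy0, pd2_eq_fderiv hF hx0 hy0,
    smul_eq_mul, smul_eq_mul, mul_comm x', mul_comm y']

lemma contDiffOn_pd1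
    (hF : ContDiffOn ℝ (⊤ : ℕ∞) (fun p : ℝ × ℝ => F p.1 p.2) (Ioi 0 ×ˢ Ioi 0)) :
    ContDiffOn ℝ (⊤ : ℕ∞) (fun p : ℝ × ℝ => pd1 F p.1 p.2) (Ioi 0 ×ˢ Ioi 0) :=
  ((hF.fderiv_of_isOpen isOpen_quadrant (m := (⊤ : ℕ∞)) (by simp)).clm_apply
    contDiffOn_const).congr fun _ hp => pd1_eq_fderiv hF hp.1 hp.2

lemma contDiffOn_pd2
    (hF : ContDiffOn ℝ (⊤ : ℕ∞) (fun p : ℝ × ℝ => F p.1 p.2) (Ioi 0 ×ˢ Ioi 0)) :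
    ContDiffOn ℝ (⊤ : ℕ∞) (fun p : ℝ × ℝ => pd2 F p.1 p.2) (Ioi 0 ×ˢ Ioi 0) :=
  ((hF.fderiv_of_isOpen isOpen_quadrant (m := (⊤ : ℕ∞)) (by simp)).clm_apply
    contDiffOn_const).congr fun _ hp => pd2_eq_fderiv hF hp.1 hp.2

lemma hasDerivAt_pd1
    (hF : ContDiffOn ℝ (⊤ : ℕ∞) (fun p : ℝ × ℝ => F p.1 p.2) (Ioi 0 ×ˢ Ioi 0))
    {c k : ℝ} (hc : 0 < c) (hk : 0 < k) : HasDerivAt (fun x => F x k) (pd1 F c k) c := by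
  simpa using hasDerivAt_comp_partials hF (hasDerivAt_id c) (hasDerivAt_const c k) hc hk

lemma strictAntiOn_pd1
    (hF : ContDiffOn ℝ (⊤ : ℕ∞) (fun p : ℝ × ℝ => F p.1 p.2) (Ioi 0 ×ˢ Ioi 0))
    (h11 : ∀ c > (0 : ℝ), ∀ k > (0 : ℝ), pd11 F c k < 0) {k : ℝ} (hk : 0 < k) :
    StrictAntiOn (fun c => pd1 F c k) (Ioi 0) := by
  refine strictAntiOn_of_deriv_neg (convex_Ioi 0)
    (fun c hc => (hasDerivAt_pd1 (contDiffOn_pd1 hF) hc hk).continuousAt.continuousWithinAt) ?_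
  rw [interior_Ioi]
  exact fun c hc => h11 c hc k hk

lemma pd1_pos
    (hF : ContDiffOn ℝ (⊤ : ℕ∞) (fun p : ℝ × ℝ => F p.1 p.2) (Ioi 0 ×ˢ Ioi 0))
    (h11 : ∀ c > (0 : ℝ), ∀ k > (0 : ℝ), pd11 F c k < 0)
    (hmono : ∀ k > (0 : ℝ), StrictMonoOn (fun c => F c k) (Ioi 0))
    {c k : ℝ} (hc : 0 < c) (hk : 0 < k) : 0 < pd1 F c k := by
  obtain ⟨x, hx, hx'⟩ := exists_hasDerivAt_eq_slope (fun x => F x k) (fun x => pd1 F x k)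
    (lt_add_one c)
    (fun x hx => (hasDerivAt_pd1 hF (hc.trans_le hx.1) hk).continuousAt.continuousWithinAt)
    (fun x hx => hasDerivAt_pd1 hF (hc.trans hx.1) hk)
  have h1 : F c k < F (c + 1) k := hmono k hk hc (show 0 < c + 1 by linarith) (lt_add_one c)
  have h2 : pd1 F x k < pd1 F c k := strictAntiOn_pd1 hF h11 hk hc (hc.trans hx.1) hx.1
  have h3 : 0 < pd1 F x k := by rw [hx']; simpa using h1
  exact h3.trans h2

lemma le_tangent
    (hF : ContDiffOn ℝ (⊤ : ℕ∞) (fun p : ℝ × ℝ => F p.1 p.2) (Ioi 0 ×ˢ Ioi 0))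
    (h11 : ∀ c > (0 : ℝ), ∀ k > (0 : ℝ), pd11 F c k < 0)
    {c c₀ k : ℝ} (hc : 0 < c) (hc₀ : 0 < c₀) (hk : 0 < k) :
    F c k ≤ F c₀ k + pd1 F c₀ k * (c - c₀) := by
  have hcd : ∀ x, 0 < x → HasDerivAt (fun x => F x k) (pd1 F x k) x :=
    fun x hx => hasDerivAt_pd1 hF hx hk
  have hanti := strictAntiOn_pd1 hF h11 hk
  rcases lt_trichotomy c c₀ with h | rfl | h
  · obtain ⟨x, hx, hx'⟩ := exists_hasDerivAt_eq_slope (fun x => F x k) (fun x => pd1 F x k) h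
      (fun x hx => (hcd x (hc.trans_le hx.1)).continuousAt.continuousWithinAt)
      (fun x hx => hcd x (hc.trans hx.1))
    have h2 : pd1 F c₀ k < pd1 F x k := hanti (hc.trans hx.1) hc₀ hx.2
    rw [hx', lt_div_iff₀ (by linarith)] at h2
    linarith
  · simp
  · obtain ⟨x, hx, hx'⟩ := exists_hasDerivAt_eq_slope (fun x => F x k) (fun x => pd1 F x k) h
      (fun x hx => (hcd x (hc₀.trans_le hx.1)).continuousAt.continuousWithinAt)
      (fun x hx => hcd x (hc₀.trans hx.1))
    have h2 : pd1 F x k < pd1 F c₀ k := hanti hc₀ (hc₀.trans hx.1) hx.1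
    rw [hx', div_lt_iff₀ (by linarith)] at h2
    linarith

end Partials

/-- The gap in the Euler equation of an agent with discount rate `δ` and utility `F`, at capital
`p.1`, excess consumption `p.2.1` and slope of excess consumption `p.2.2`. -/
noncomputable def eulerGap (f : ℝ → ℝ) (F : ℝ → ℝ → ℝ) (δ : ℝ) (p : ℝ × ℝ × ℝ) : ℝ :=
  pd1 F (f p.1 + p.2.1) p.1 * (δ - deriv f p.1) - pd2 F (f p.1 + p.2.1) p.1 +
    p.2.1 * (pd1 (pd1 F) (f p.1 + p.2.1) p.1 * (deriv f p.1 + p.2.2) +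
      pd2 (pd1 F) (f p.1 + p.2.1) p.1)

lemma contDiffAt_comp_consumption {f : ℝ → ℝ} {F : ℝ → ℝ → ℝ}
    (hf : ContDiffOn ℝ (⊤ : ℕ∞) f (Ioi 0))
    (hF : ContDiffOn ℝ (⊤ : ℕ∞) (fun p : ℝ × ℝ => F p.1 p.2) (Ioi 0 ×ˢ Ioi 0))
    {p : ℝ × ℝ × ℝ} (hp : 0 < p.1) (hc : 0 < f p.1 + p.2.1) :
    ContDiffAt ℝ (⊤ : ℕ∞) (fun p : ℝ × ℝ × ℝ => F (f p.1 + p.2.1) p.1) p := by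
  have hfa : ContDiffAt ℝ (⊤ : ℕ∞) (fun p : ℝ × ℝ × ℝ => f p.1) p :=
    (hf.contDiffAt (isOpen_Ioi.mem_nhds hp)).comp p contDiffAt_fst
  have hpair : ContDiffAt ℝ (⊤ : ℕ∞) (fun p : ℝ × ℝ × ℝ => (f p.1 + p.2.1, p.1)) p :=
    (hfa.add (by fun_prop)).prodMk contDiffAt_fst
  exact ContDiffAt.comp p (g := fun p : ℝ × ℝ => F p.1 p.2)
    (hF.contDiffAt (isOpen_quadrant.mem_nhds
      (show (f p.1 + p.2.1, p.1) ∈ Ioi (0 : ℝ) ×ˢ Ioi (0 : ℝ) from ⟨hc, hp⟩))) hpair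

lemma contDiffAt_eulerGap {f : ℝ → ℝ} {F : ℝ → ℝ → ℝ} {δ : ℝ}
    (hf : ContDiffOn ℝ (⊤ : ℕ∞) f (Ioi 0))
    (hF : ContDiffOn ℝ (⊤ : ℕ∞) (fun p : ℝ × ℝ => F p.1 p.2) (Ioi 0 ×ˢ Ioi 0))
    {p : ℝ × ℝ × ℝ} (hp : 0 < p.1) (hc : 0 < f p.1 + p.2.1) :
    ContDiffAt ℝ (⊤ : ℕ∞) (eulerGap f F δ) p := by
  have h1 := contDiffAt_comp_consumption hf (contDiffOn_pd1 hF) hp hc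
  have h2 := contDiffAt_comp_consumption hf (contDiffOn_pd2 hF) hp hc
  have h11 := contDiffAt_comp_consumption hf (contDiffOn_pd1 (contDiffOn_pd1 hF)) hp hc
  have h12 := contDiffAt_comp_consumption hf (contDiffOn_pd2 (contDiffOn_pd1 hF)) hp hc
  have hdf : ContDiffAt ℝ (⊤ : ℕ∞) (fun p : ℝ × ℝ × ℝ => deriv f p.1) p :=
    ((hf.deriv_of_isOpen isOpen_Ioi (m := (⊤ : ℕ∞)) (by simp)).contDiffAt
      (isOpen_Ioi.mem_nhds hp)).comp p contDiffAt_fst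
  have hg : ContDiffAt ℝ (⊤ : ℕ∞) (fun p : ℝ × ℝ × ℝ => p.2.1) p := by fun_prop
  have hr : ContDiffAt ℝ (⊤ : ℕ∞) (fun p : ℝ × ℝ × ℝ => p.2.2) p := by fun_prop
  exact ((h1.mul (contDiffAt_const.sub hdf)).sub h2).add
    (hg.mul ((h11.mul (hdf.add hr)).add h12))

lemma fderiv_eulerGap {f : ℝ → ℝ} {F : ℝ → ℝ → ℝ} {δ : ℝ}
    (hf : ContDiffOn ℝ (⊤ : ℕ∞) f (Ioi 0))
    (hF : ContDiffOn ℝ (⊤ : ℕ∞) (fun p : ℝ × ℝ => F p.1 p.2) (Ioi 0 ×ˢ Ioi 0))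
    {p : ℝ × ℝ × ℝ} (hp : 0 < p.1) (hc : 0 < f p.1 + p.2.1) :
    fderiv ℝ (eulerGap f F δ) p (0, 0, 1) = p.2.1 * pd1 (pd1 F) (f p.1 + p.2.1) p.1 := by
  have hd := (contDiffAt_eulerGap (δ := δ) hf hF hp hc).differentiableAt (by simp)
  rw [← hd.lineDeriv_eq_fderiv]
  obtain ⟨k, g, r⟩ := p
  refine HasDerivAt.deriv ?_
  simp only [eulerGap, Prod.smul_mk, smul_eq_mul, mul_zero, mul_one, Prod.mk_add_mk, add_zero]
  have h := (((((hasDerivAt_id (0 : ℝ)).const_add r).const_add (deriv f k)).const_mul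
    (pd1 (pd1 F) (f k + g) k)).add_const (pd2 (pd1 F) (f k + g) k)).const_mul g
  exact (h.const_add _).congr_deriv (by simp)

/-- A strategy whose first order condition holds is optimal among one-shot deviations. -/
lemma Pval_le_of_firstOrder {u W : ℝ → ℝ → ℝ} {h H σ : ℝ → ℝ} {K R : ℝ → ℝ → ℝ} {k c : ℝ}
    (hu : ContDiffOn ℝ (⊤ : ℕ∞) (fun p : ℝ × ℝ => u p.1 p.2) (Ioi 0 ×ˢ Ioi 0))
    (hW : ContDiffOn ℝ (⊤ : ℕ∞) (fun p : ℝ × ℝ => W p.1 p.2) (Ioi 0 ×ˢ Ioi 0))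
    (hu11 : ∀ c > (0 : ℝ), ∀ k > (0 : ℝ), pd11 u c k < 0)
    (hW11 : ∀ c > (0 : ℝ), ∀ k > (0 : ℝ), pd11 W c k < 0)
    (hk : 0 < k) (hσ : 0 < σ k) (hc : 0 < c)
    (hI : ∫ t in Ioi 0,
      (h t * (pd1 u (σ (K t k)) (K t k) * deriv σ (K t k) + pd2 u (σ (K t k)) (K t k)) +
        H t * (pd1 W (σ (K t k)) (K t k) * deriv σ (K t k) + pd2 W (σ (K t k)) (K t k))) * R k t =
      pd1 u (σ k) k + pd1 W (σ k) k) :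
    Pval u W h H σ K R k c ≤ Pval u W h H σ K R k (σ k) := by
  have h1 := le_tangent hu hu11 hc hσ hk
  have h2 := le_tangent hW hW11 hc hσ hk
  simp only [Pval, ← mul_assoc, integral_mul_const, hI]
  linarith

/-- Existence of a convergent equilibrium, in terms of the Euler gaps of the two agents. -/
lemma exists_equilibrium_strategy {f : ℝ → ℝ} {u W : ℝ → ℝ → ℝ} {δ₁ δ₂ kinf : ℝ}
    (hδ : δ₂ < δ₁) (hδ₂ : 0 < δ₂)
    (hf : ContDiffOn ℝ (⊤ : ℕ∞) f (Ioi 0))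
    (hu : ContDiffOn ℝ (⊤ : ℕ∞) (fun p : ℝ × ℝ => u p.1 p.2) (Ioi 0 ×ˢ Ioi 0))
    (hW : ContDiffOn ℝ (⊤ : ℕ∞) (fun p : ℝ × ℝ => W p.1 p.2) (Ioi 0 ×ˢ Ioi 0))
    (hu11 : ∀ c > (0 : ℝ), ∀ k > (0 : ℝ), pd11 u c k < 0)
    (hW11 : ∀ c > (0 : ℝ), ∀ k > (0 : ℝ), pd11 W c k < 0)
    (hkinf : 0 < kinf) (hfkinf : 0 < f kinf) {a b : ℝ}
    (ha : a = pd1 u (f kinf) kinf * (δ₁ - deriv f kinf) - pd2 u (f kinf) kinf)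
    (hb : b = pd1 W (f kinf) kinf * (δ₂ - deriv f kinf) - pd2 W (f kinf) kinf)
    (hab : (a + b) * (δ₂ * a + δ₁ * b) < 0) :
    ∃ N : Set ℝ, IsOpen N ∧ kinf ∈ N ∧ N ⊆ Set.Ioi 0 ∧
    ∃ σ : ℝ → ℝ, ContDiffOn ℝ 1 σ N ∧ (∀ k ∈ N, 0 < σ k) ∧
    ∃ K R : ℝ → ℝ → ℝ,
      (∀ k₀ ∈ N, K 0 k₀ = k₀) ∧
      (∀ k₀ ∈ N, ∀ t : ℝ, 0 ≤ t →
        HasDerivAt (fun s => K s k₀) (f (K t k₀) - σ (K t k₀)) t) ∧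
      (∀ k₀ ∈ N, ∀ t : ℝ, 0 ≤ t → K t k₀ ∈ N) ∧
      (∀ k₀ ∈ N, Tendsto (fun t => K t k₀) atTop (nhds kinf)) ∧
      (∀ k₀ ∈ N, R k₀ 0 = 1) ∧
      (∀ k₀ ∈ N, ∀ t : ℝ, 0 ≤ t →
        HasDerivAt (R k₀) ((deriv f (K t k₀) - deriv σ (K t k₀)) * R k₀ t) t) ∧
      ∀ k ∈ N, ∀ c > (0:ℝ),
        Pval u W (fun t => Real.exp (-δ₁ * t)) (fun t => Real.exp (-δ₂ * t)) σ K R k c ≤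
        Pval u W (fun t => Real.exp (-δ₁ * t)) (fun t => Real.exp (-δ₂ * t)) σ K R k (σ k) := by
  have hm : a + b ≠ 0 := fun h => by simp [h] at hab
  obtain ⟨s, hs⟩ : ∃ s, s = -(δ₂ * a + δ₁ * b) / (a + b) := ⟨_, rfl⟩
  have hsm : δ₂ * a + δ₁ * b = -(a + b) * s := by rw [hs]; field_simp
  have hs0 : 0 < s := by
    rw [hsm] at hab
    have h2 : 0 < (a + b) ^ 2 := by positivity
    by_contra! h
    nlinarith
  have hΔ : δ₁ - δ₂ ≠ 0 := by linarith
  set A := eulerGap f u δ₁ with hA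
  set B := eulerGap f W δ₂ with hB
  have hA0 : ∀ r, A (kinf, 0, r) = a := fun r => by simp [hA, eulerGap, ha]
  have hB0 : ∀ r, B (kinf, 0, r) = b := fun r => by simp [hB, eulerGap, hb]
  have hAs : ContDiffAt ℝ (⊤ : ℕ∞) A (kinf, 0, s) :=
    contDiffAt_eulerGap hf hu hkinf (by simpa using hfkinf)
  have hBs : ContDiffAt ℝ (⊤ : ℕ∞) B (kinf, 0, s) :=
    contDiffAt_eulerGap hf hW hkinf (by simpa using hfkinf)
  have hfc : ContinuousAt f kinf := (hf.contDiffAt (isOpen_Ioi.mem_nhds hkinf)).continuousAt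
  obtain ⟨ε₀, hε₀, ρ, g, hρc, hρ0, hg0, hgd, hMd⟩ := exists_solution_balance
    (M := fun p => A p + B p) (D := fun p => δ₂ * A p + δ₁ * B p)
    (e := fun p => pd1 (pd1 u) (f p.1 + p.2.1) p.1 + pd1 (pd1 W) (f p.1 + p.2.1) p.1)
    (k₀ := kinf) hs0 hm (contDiffAt_infty.1 (hAs.add hBs) 2)
    (((contDiffAt_const.mul hAs).add (contDiffAt_const.mul hBs)).of_le (by exact_mod_cast le_top))
    (((contDiffAt_comp_consumption hf (contDiffOn_pd1 (contDiffOn_pd1 hu)) hkinf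
      (by simpa using hfkinf)).add
      (contDiffAt_comp_consumption hf (contDiffOn_pd1 (contDiffOn_pd1 hW)) hkinf
      (by simpa using hfkinf))).of_le (by exact_mod_cast le_top))
    (by
      have h1 := hu11 (f kinf + 0) (by simpa using hfkinf) kinf hkinf
      have h2 := hW11 (f kinf + 0) (by simpa using hfkinf) kinf hkinf
      exact (add_neg h1 h2).ne)
    (by
      have hc1 : ContinuousAt (fun p : ℝ × ℝ × ℝ => p.1) (kinf, 0, s) := continuousAt_fst
      have hc2 : ContinuousAt (fun p : ℝ × ℝ × ℝ => f p.1 + p.2.1) (kinf, 0, s) :=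
        (ContinuousAt.comp (g := f) (f := fun p : ℝ × ℝ × ℝ => p.1) hfc hc1).add (by fun_prop)
      filter_upwards [hc1.eventually_const_lt (u := 0) hkinf,
        hc2.eventually_const_lt (u := 0) (by simpa using hfkinf)] with p hp1 hp2
      have h1 := (contDiffAt_eulerGap (δ := δ₁) hf hu hp1 hp2).differentiableAt (by simp)
      have h2 := (contDiffAt_eulerGap (δ := δ₂) hf hW hp1 hp2).differentiableAt (by simp)
      rw [fderiv_fun_add h1 h2, _root_.add_apply, fderiv_eulerGap hf hu hp1 hp2,
        fderiv_eulerGap hf hW hp1 hp2, mul_add])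
    (Eventually.of_forall fun r => by simp only [hA0, hB0, hsm]; ring)
  have hgc : Continuous g := continuous_iff_continuousAt.2 fun k => (hgd k).continuousAt
  obtain ⟨ε₁, hε₁, hnear⟩ : ∃ ε > 0, ∀ k, |k - kinf| < ε →
      0 < k ∧ 0 < f k + g k ∧ s / 2 < ρ k ∧ ρ k < 2 * s := by
    have h : ∀ᶠ k in 𝓝 kinf, 0 < k ∧ 0 < f k + g k ∧ s / 2 < ρ k ∧ ρ k < 2 * s :=
      (eventually_gt_nhds hkinf).and
        (((hfc.add hgc.continuousAt).eventually_const_lt (by simpa [hg0] using hfkinf)).and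
          ((hρc.continuousAt.eventually_const_lt (by rw [hρ0]; linarith)).and
            (hρc.continuousAt.eventually_lt_const (by rw [hρ0]; linarith))))
    obtain ⟨ε, hε, h⟩ := Metric.eventually_nhds_iff.1 h
    exact ⟨ε, hε, fun k hk => h (by rwa [Real.dist_eq])⟩
  obtain ⟨ε, hε⟩ : ∃ ε, ε = min ε₀ ε₁ := ⟨_, rfl⟩
  have hεpos : 0 < ε := hε ▸ lt_min hε₀ hε₁
  have hlt0 : ∀ {k : ℝ}, |k - kinf| < ε → |k - kinf| < ε₀ := fun h =>
    h.trans_le (hε ▸ min_le_left _ _)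
  have hN : ∀ k, |k - kinf| < ε → 0 < k ∧ 0 < f k + g k ∧ s / 2 < ρ k ∧ ρ k < 2 * s := fun k h =>
    hnear k (h.trans_le (hε ▸ min_le_right _ _))
  have hopen : IsOpen {k | |k - kinf| < ε} := isOpen_lt (by fun_prop) continuous_const
  have hfd : ∀ k, 0 < k → HasDerivAt f (deriv f k) k := fun k hk =>
    ((hf.contDiffAt (isOpen_Ioi.mem_nhds hk)).differentiableAt (by simp)).hasDerivAt
  obtain ⟨σ, hσ⟩ : ∃ σ : ℝ → ℝ, σ = fun k => f k + g k := ⟨_, rfl⟩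
  have hσd : ∀ k, |k - kinf| < ε → HasDerivAt σ (deriv f k + ρ k) k := fun k hk =>
    hσ ▸ (hfd k (hN k hk).1).add (hgd k)
  have hσ0 : ∀ k, |k - kinf| < ε → 0 < σ k := fun k hk => hσ ▸ (hN k hk).2.1
  have hfdc : ContinuousOn (deriv f) (Ioi 0) :=
    (hf.deriv_of_isOpen isOpen_Ioi (m := (⊤ : ℕ∞)) (by simp)).continuousOn
  have hσdc : ContinuousOn (deriv σ) {k | |k - kinf| < ε} :=
    ((hfdc.mono fun k hk => (hN k hk).1).add hρc.continuousOn).congr fun k hk => (hσd k hk).deriv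
  have htraj : ∀ k, ∃ K : ℝ → ℝ, |k - kinf| < ε → K 0 = k ∧ Continuous K ∧
      (∀ t, 0 ≤ t → HasDerivAt K (-g (K t)) t) ∧ (∀ t, 0 ≤ t → |K t - kinf| < ε) ∧
      Tendsto K atTop (𝓝 kinf) ∧ ((∀ t, K t ≠ kinf) ∨ ∀ t, K t = kinf) := fun k => by
    by_cases hk : |k - kinf| < ε
    · obtain ⟨K, hK⟩ := exists_attracted_trajectory (half_pos hs0) hg0 hgd
        (fun k hk => ⟨(hN k hk).2.2.1.le, (hN k hk).2.2.2.le⟩) hk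
      exact ⟨K, fun _ => hK⟩
    · exact ⟨0, fun h => absurd h hk⟩
  choose K hK using htraj
  set R : ℝ → ℝ → ℝ := fun k t => Real.exp (-∫ τ in (0 : ℝ)..t, ρ (K k τ)) with hR
  have hRd : ∀ k, |k - kinf| < ε → ∀ t, HasDerivAt (R k) (-ρ (K k t) * R k t) t := fun k hk t => by
    have h := ((hρc.comp (hK k hk).2.1).integral_hasStrictDerivAt 0 t).hasDerivAt.neg.exp
    exact h.congr_deriv (mul_comm _ _)
  have hR0 : ∀ k, R k 0 = 1 := fun k => by simp [hR]
  have hRb : ∀ k, |k - kinf| < ε → ∀ t, 0 ≤ t → |R k t| ≤ 1 := fun k hk t ht => by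
    rw [abs_of_pos (Real.exp_pos _), Real.exp_le_one_iff, neg_nonpos]
    refine intervalIntegral.integral_nonneg ht fun τ hτ => ?_
    exact (half_pos hs0).le.trans (hN _ ((hK k hk).2.2.2.1 τ hτ.1)).2.2.1.le
  refine ⟨{k | |k - kinf| < ε}, hopen, by simpa using hεpos, fun k hk => (hN k hk).1, σ, ?_, hσ0,
    fun t k => K k t, R, fun k hk => (hK k hk).1, fun k hk t ht => ?_,
    fun k hk t ht => (hK k hk).2.2.2.1 t ht, fun k hk => (hK k hk).2.2.2.2.1, fun k _ => hR0 k,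
    fun k hk t ht => ?_, fun k hk c hc => ?_⟩
  · refine (contDiffOn_succ_iff_deriv_of_isOpen (n := 0) hopen).2
      ⟨fun k hk => ?_, by simp, contDiffOn_zero.2 hσdc⟩
    exact (hσd k hk).differentiableAt.differentiableWithinAt
  · exact ((hK k hk).2.2.1 t ht).congr_deriv (by rw [hσ]; ring)
  · refine (hRd k hk t).congr_deriv ?_
    rw [(hσd _ ((hK k hk).2.2.2.1 t ht)).deriv]
    ring
  refine Pval_le_of_firstOrder hu hW hu11 hW11 (hN k hk).1 (hσ0 k hk) hc ?_
  obtain ⟨hK0, hKc, hKd, hKN, hKlim, hKalt⟩ := hK k hk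
  set G : ℝ → ℝ := fun k => A (k, g k, ρ k) + B (k, g k, ρ k) with hG
  have hGd : ∀ t, 0 ≤ t → HasDerivAt (fun t => G (K k t))
      (δ₂ * A (K k t, g (K k t), ρ (K k t)) + δ₁ * B (K k t, g (K k t), ρ (K k t)) +
        ρ (K k t) * G (K k t)) t := fun t ht => by
    rcases hKalt with h | h
    · have hg : g (K k t) ≠ 0 := ne_zero_of_hasDerivAt_pos hg0 hgd
        (fun x hx => (half_pos hs0).trans (hN x hx).2.2.1) (h t) (hKN t ht)
      refine ((hMd _ (h t) (hlt0 (hKN t ht))).comp t (hKd t ht)).congr_deriv ?_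
      field_simp
      simp only [hG]
    · simp only [h, hg0, hρ0, hG, hA0, hB0]
      exact (hasDerivAt_const t _).congr_deriv (by rw [hsm]; ring)
  have hGc : ContinuousAt G kinf := by
    have hpair : ContinuousAt (fun k => (k, g k, ρ k)) kinf := by fun_prop
    have h1 : ContinuousAt (fun k => A (k, g k, ρ k)) kinf :=
      ContinuousAt.comp (g := A) (by rw [hg0, hρ0]; exact hAs.continuousAt) hpair
    have h2 : ContinuousAt (fun k => B (k, g k, ρ k)) kinf :=
      ContinuousAt.comp (g := B) (by rw [hg0, hρ0]; exact hBs.continuousAt) hpair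
    exact h1.add h2
  have hcont : ∀ F : ℝ → ℝ → ℝ,
      ContDiffOn ℝ (⊤ : ℕ∞) (fun p : ℝ × ℝ => F p.1 p.2) (Ioi 0 ×ˢ Ioi 0) →
      ContinuousOn (fun k => F (σ k) k) {k | |k - kinf| < ε} := fun F hF =>
    hF.continuousOn.comp (t := Ioi 0 ×ˢ Ioi 0) (f := fun k => (σ k, k))
      (fun x hx => ((hσd x hx).continuousAt.prodMk continuousAt_id).continuousWithinAt)
      fun x hx => ⟨hσ0 x hx, (hN x hx).1⟩
  have hkN : kinf ∈ {k | |k - kinf| < ε} := by simpa using hεpos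
  have hKmaps : MapsTo (K k) (Ici 0) {k | |k - kinf| < ε} := fun t ht => hKN t ht
  have hagent : ∀ (F : ℝ → ℝ → ℝ) (δ κ : ℝ), 0 < δ →
      ContDiffOn ℝ (⊤ : ℕ∞) (fun p : ℝ × ℝ => F p.1 p.2) (Ioi 0 ×ˢ Ioi 0) →
      (∀ p, (δ₂ * A p + δ₁ * B p) * κ - δ * κ * (A p + B p) = eulerGap f F δ p) →
      IntegrableOn (fun t => Real.exp (-δ * t) * (pd1 F (σ (K k t)) (K k t) * deriv σ (K k t) +
        pd2 F (σ (K k t)) (K k t)) * R k t) (Ioi 0) ∧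
      ∫ t in Ioi 0, Real.exp (-δ * t) * (pd1 F (σ (K k t)) (K k t) * deriv σ (K k t) +
        pd2 F (σ (K k t)) (K k t)) * R k t = pd1 F (σ k) k + κ * G k := by
    intro F δ κ hδ hF hκ
    have hlim := hcont _ (contDiffOn_pd1 hF)
    have ha := ((hcont _ (contDiffOn_pd1 hF)).mul hσdc).add (hcont _ (contDiffOn_pd2 hF))
    have hy : ∀ t, 0 ≤ t → HasDerivAt (fun t => pd1 F (σ (K k t)) (K k t) + κ * G (K k t))
        ((δ + ρ (K k t)) * (pd1 F (σ (K k t)) (K k t) + κ * G (K k t)) -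
          (pd1 F (σ (K k t)) (K k t) * deriv σ (K k t) + pd2 F (σ (K k t)) (K k t))) t := by
      intro t ht
      have hσt := hσd _ (hKN t ht)
      have h1 := hasDerivAt_comp_partials (contDiffOn_pd1 hF) (hσt.comp t (hKd t ht)) (hKd t ht)
        (hσ0 _ (hKN t ht)) (hN _ (hKN t ht)).1
      refine (h1.add ((hGd t ht).const_mul κ)).congr_deriv ?_
      have h2 := hκ (K k t, g (K k t), ρ (K k t))
      rw [hσt.deriv]
      simp only [eulerGap, hG, hσ, Function.comp_apply] at h2 ⊢
      linear_combination h2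
    have h := integral_discounted_eq hδ hy (fun t _ => hRd k hk t) (hR0 k) (hRb k hk)
      (ha.comp hKc.continuousOn hKmaps) ((ha.continuousAt (hopen.mem_nhds hkN)).tendsto.comp hKlim)
      (((hlim.continuousAt (hopen.mem_nhds hkN)).add (hGc.const_mul κ)).tendsto.comp hKlim)
    simpa only [hK0] using h
  obtain ⟨hi1, h1⟩ := hagent u δ₁ (-(δ₁ - δ₂)⁻¹) (hδ₂.trans hδ) hu fun p => by
    rw [← hA]; field_simp; ring
  obtain ⟨hi2, h2⟩ := hagent W δ₂ (δ₁ - δ₂)⁻¹ hδ₂ hW fun p => by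
    rw [← hB]; field_simp; ring
  refine (integral_congr_ae (Eventually.of_forall fun t => add_mul _ _ _)).trans ?_
  rw [integral_add hi1 hi2, h1, h2]
  ring

/-- The steady-state condition in terms of the marginal gaps of the two agents. -/
lemma mul_neg_of_between {u₁ u₂ v₁ v₂ x δ₁ δ₂ lam : ℝ} (hδ : δ₂ < δ₁) (hδ₂ : 0 < δ₂)
    (hlam0 : 0 < lam) (hlam1 : lam < 1) (hu : 0 < u₁) (hv : 0 < v₁)
    (h : ((lam * u₁ + (1 - lam) * v₁) / (lam / δ₁ * u₁ + (1 - lam) / δ₂ * v₁) -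
        (lam * δ₂ * u₂ + (1 - lam) * δ₁ * v₂) / (lam * δ₂ * u₁ + (1 - lam) * δ₁ * v₁) < x ∧
      x < (lam * δ₁ * u₁ + (1 - lam) * δ₂ * v₁) / (lam * u₁ + (1 - lam) * v₁) -
        (lam * u₂ + (1 - lam) * v₂) / (lam * u₁ + (1 - lam) * v₁)) ∨
      ((lam * δ₁ * u₁ + (1 - lam) * δ₂ * v₁) / (lam * u₁ + (1 - lam) * v₁) -
        (lam * u₂ + (1 - lam) * v₂) / (lam * u₁ + (1 - lam) * v₁) < x ∧
      x < (lam * u₁ + (1 - lam) * v₁) / (lam / δ₁ * u₁ + (1 - lam) / δ₂ * v₁) -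
        (lam * δ₂ * u₂ + (1 - lam) * δ₁ * v₂) / (lam * δ₂ * u₁ + (1 - lam) * δ₁ * v₁))) :
    (u₁ * (δ₁ - x) - u₂ + ((1 - lam) / lam * v₁ * (δ₂ - x) - (1 - lam) / lam * v₂)) *
      (δ₂ * (u₁ * (δ₁ - x) - u₂) +
        δ₁ * ((1 - lam) / lam * v₁ * (δ₂ - x) - (1 - lam) / lam * v₂)) < 0 := by
  have hδ₁ : 0 < δ₁ := hδ₂.trans hδ
  have hl : 0 < 1 - lam := by linarith
  have hP : 0 < lam * u₁ + (1 - lam) * v₁ := by positivity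
  have hQ : 0 < lam * δ₂ * u₁ + (1 - lam) * δ₁ * v₁ := by positivity
  have hS : lam / δ₁ * u₁ + (1 - lam) / δ₂ * v₁ =
      (lam * δ₂ * u₁ + (1 - lam) * δ₁ * v₁) / (δ₁ * δ₂) := by field_simp
  have hupper : (lam * δ₁ * u₁ + (1 - lam) * δ₂ * v₁) / (lam * u₁ + (1 - lam) * v₁) -
      (lam * u₂ + (1 - lam) * v₂) / (lam * u₁ + (1 - lam) * v₁) = x +
      (u₁ * (δ₁ - x) - u₂ + ((1 - lam) / lam * v₁ * (δ₂ - x) - (1 - lam) / lam * v₂)) *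
      (lam / (lam * u₁ + (1 - lam) * v₁)) := by
    field_simp; ring
  have hlower : (lam * u₁ + (1 - lam) * v₁) / (lam / δ₁ * u₁ + (1 - lam) / δ₂ * v₁) -
      (lam * δ₂ * u₂ + (1 - lam) * δ₁ * v₂) / (lam * δ₂ * u₁ + (1 - lam) * δ₁ * v₁) = x +
      (δ₂ * (u₁ * (δ₁ - x) - u₂) +
        δ₁ * ((1 - lam) / lam * v₁ * (δ₂ - x) - (1 - lam) / lam * v₂)) *
      (lam / (lam * δ₂ * u₁ + (1 - lam) * δ₁ * v₁)) := by
    rw [hS]; field_simp; ring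
  rw [hupper, hlower] at h
  have hp := div_pos hlam0 hP
  have hq := div_pos hlam0 hQ
  rcases h with ⟨h1, h2⟩ | ⟨h1, h2⟩
  · exact mul_neg_of_pos_of_neg (pos_of_mul_pos_left (by linarith) hp.le)
      (neg_of_mul_neg_left (by linarith) hq.le)
  · exact mul_neg_of_neg_of_pos (neg_of_mul_neg_left (by linarith) hp.le)
      (pos_of_mul_pos_left (by linarith) hq.le)

/-- Existence of equilibrium strategies in the biexponential case.
If `f'(k∞)` lies strictly between `g̲_λ(k∞)` and `ḡ_λ(k∞)`, then there exists an
equilibrium strategy (for the biexponential time-inconsistent problem) defined on a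
neighborhood of `k∞`, whose trajectories converge to `k∞`. -/
theorem stmt_11
    (f : ℝ → ℝ) (u U : ℝ → ℝ → ℝ) (δ₁ δ₂ lam : ℝ)
    (hδ : δ₂ < δ₁) (hδ₂ : 0 < δ₂) (hlam0 : 0 < lam) (hlam1 : lam < 1)
    (hf_conc : ConcaveOn ℝ (Set.Ici 0) f)
    (hf_cont : ContinuousOn f (Set.Ici 0))
    (hf_smooth : ContDiffOn ℝ (⊤ : ℕ∞) f (Set.Ioi 0))
    (hf_inada0 : Tendsto (deriv f) (nhdsWithin 0 (Set.Ioi 0)) atTop)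
    (hf_inada1 : ∃ L ≤ (0:ℝ), Tendsto (deriv f) atTop (nhds L))
    (hu_smooth : ContDiffOn ℝ (⊤ : ℕ∞) (fun p : ℝ × ℝ => u p.1 p.2) (Set.Ioi 0 ×ˢ Set.Ioi 0))
    (hU_smooth : ContDiffOn ℝ (⊤ : ℕ∞) (fun p : ℝ × ℝ => U p.1 p.2) (Set.Ioi 0 ×ˢ Set.Ioi 0))
    (hu_mono : ∀ k > (0:ℝ), StrictMonoOn (fun c => u c k) (Set.Ioi 0))
    (hU_mono : ∀ k > (0:ℝ), StrictMonoOn (fun c => U c k) (Set.Ioi 0))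
    (hu11 : ∀ c > (0:ℝ), ∀ k > (0:ℝ), pd11 u c k < 0)
    (hU11 : ∀ c > (0:ℝ), ∀ k > (0:ℝ), pd11 U c k < 0)
    (kinf : ℝ) (hkinf : 0 < kinf) (hfkinf : 0 < f kinf)
    (hbetween :
      (gunder f u U lam δ₁ δ₂ kinf < deriv f kinf ∧
        deriv f kinf < gbar f u U lam δ₁ δ₂ kinf) ∨
      (gbar f u U lam δ₁ δ₂ kinf < deriv f kinf ∧
        deriv f kinf < gunder f u U lam δ₁ δ₂ kinf)) :
    ∃ N : Set ℝ, IsOpen N ∧ kinf ∈ N ∧ N ⊆ Set.Ioi 0 ∧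
    ∃ σ : ℝ → ℝ, ContDiffOn ℝ 1 σ N ∧ (∀ k ∈ N, 0 < σ k) ∧
    ∃ K R : ℝ → ℝ → ℝ,
      (∀ k₀ ∈ N, K 0 k₀ = k₀) ∧
      (∀ k₀ ∈ N, ∀ t : ℝ, 0 ≤ t →
        HasDerivAt (fun s => K s k₀) (f (K t k₀) - σ (K t k₀)) t) ∧
      (∀ k₀ ∈ N, ∀ t : ℝ, 0 ≤ t → K t k₀ ∈ N) ∧
      (∀ k₀ ∈ N, Tendsto (fun t => K t k₀) atTop (nhds kinf)) ∧
      (∀ k₀ ∈ N, R k₀ 0 = 1) ∧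
      (∀ k₀ ∈ N, ∀ t : ℝ, 0 ≤ t →
        HasDerivAt (R k₀) ((deriv f (K t k₀) - deriv σ (K t k₀)) * R k₀ t) t) ∧
      ∀ k ∈ N, ∀ c > (0:ℝ),
        Pval u (fun c' k' => (1 - lam) / lam * U c' k')
          (fun t => Real.exp (-δ₁ * t)) (fun t => Real.exp (-δ₂ * t)) σ K R k c ≤
        Pval u (fun c' k' => (1 - lam) / lam * U c' k')
          (fun t => Real.exp (-δ₁ * t)) (fun t => Real.exp (-δ₂ * t)) σ K R k (σ k) := by
  set μ := (1 - lam) / lam with hμ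
  have hμ0 : 0 < μ := div_pos (by linarith) hlam0
  have h1W : pd1 (fun c k => μ * U c k) = fun c k => μ * pd1 U c k := by
    funext c k; exact deriv_const_mul_field _
  have h2W : pd2 (fun c k => μ * U c k) = fun c k => μ * pd2 U c k := by
    funext c k; exact deriv_const_mul_field _
  have h11W : ∀ c > (0 : ℝ), ∀ k > (0 : ℝ), pd11 (fun c k => μ * U c k) c k < 0 := by
    intro c hc k hk
    have h : pd11 (fun c k => μ * U c k) c k = μ * pd11 U c k := by
      unfold pd11
      rw [h1W]
      exact deriv_const_mul_field _
    rw [h]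
    exact mul_neg_of_pos_of_neg hμ0 (hU11 c hc k hk)
  refine exists_equilibrium_strategy hδ hδ₂ hf_smooth hu_smooth (contDiffOn_const.mul hU_smooth)
    hu11 h11W hkinf hfkinf rfl rfl ?_
  have hup := pd1_pos hu_smooth hu11 hu_mono hfkinf hkinf
  have hUp := pd1_pos hU_smooth hU11 hU_mono hfkinf hkinf
  simp only [h1W, h2W]
  simp only [gbar, gunder] at hbetween
  generalize pd1 u (f kinf) kinf = u₁ at *
  generalize pd2 u (f kinf) kinf = u₂ at *
  generalize pd1 U (f kinf) kinf = v₁ at *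
  generalize pd2 U (f kinf) kinf = v₂ at *
  generalize deriv f kinf = x at *
  exact mul_neg_of_between hδ hδ₂ hlam0 hlam1 hup hUp hbetween
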